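/- The limits lim_{b→1⁻} g(b)/(1−b)² and lim_{R→∞, R² ∈ 2πℕ} c(R)/R² both exist and are equal to a universal constant E₂ with E₂ ∈ [−1/2, 0). -/

import Mathlib

open MeasureTheory Filter Set

noncomputable section

/-- The canonical 2D magnetic potential `A₀(x) = (-x₂/2, x₁/2)`. -/
def A0 (x : ℝ × ℝ) : ℝ × ℝ := (-x.2 / 2, x.1 / 2)

/-- The open square `K_R = (-R/2, R/2) × (-R/2, R/2)` in `ℝ²`. -/
def KR (R : ℝ) : Set (ℝ × ℝ) := Ioo (-R/2) (R/2) ×ˢ Ioo (-R/2) (R/2)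

/-- First component of the magnetic gradient `(∇ - iA₀)u`. -/
def D1 (u : ℝ × ℝ → ℂ) (x : ℝ × ℝ) : ℂ :=
  fderiv ℝ u x (1, 0) - Complex.I * ((A0 x).1 : ℂ) * u x

/-- Second component of the magnetic gradient `(∇ - iA₀)u`. -/
def D2 (u : ℝ × ℝ → ℂ) (x : ℝ × ℝ) : ℂ :=
  fderiv ℝ u x (0, 1) - Complex.I * ((A0 x).2 : ℂ) * u x

/-- The two-dimensional Ginzburg–Landau energy `G_{b,K_R}(u)`. -/
def G2 (b R : ℝ) (u : ℝ × ℝ → ℂ) : ℝ :=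
  ∫ x in KR R, (b * (‖D1 u x‖ ^ 2 + ‖D2 u x‖ ^ 2) - ‖u x‖ ^ 2 + (1/2) * ‖u x‖ ^ 4)

/-- `m₀(b,R)`: the ground state energy of `G_{b,K_R}` with Dirichlet boundary conditions,
realized (by density) as the infimum over smooth functions compactly supported in `K_R`. -/
def m0 (b R : ℝ) : ℝ :=
  sInf {E : ℝ | ∃ u : ℝ × ℝ → ℂ, ContDiff ℝ (⊤ : ℕ∞) u ∧ HasCompactSupport u ∧
    tsupport u ⊆ KR R ∧ E = G2 b R u}

/-- The magnetic periodicity conditions defining the space `E_R`. -/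
def MagPeriodic (R : ℝ) (u : ℝ × ℝ → ℂ) : Prop :=
  ∀ x : ℝ × ℝ,
    u (x.1 + R, x.2) = Complex.exp (Complex.I * (R * x.2 / 2)) * u x ∧
    u (x.1, x.2 + R) = Complex.exp (-(Complex.I * (R * x.1 / 2))) * u x

/-- `m_p(b,R)`: the ground state energy of `G_{b,K_R}` over the magnetically periodic space
`E_R`, realized (by elliptic regularity/density) over smooth magnetic periodic functions. -/
def mp (b R : ℝ) : ℝ :=
  sInf {E : ℝ | ∃ u : ℝ × ℝ → ℂ, ContDiff ℝ (⊤ : ℕ∞) u ∧ MagPeriodic R u ∧ E = G2 b R u}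

/-- The lowest Landau band equation `(∂₁ + i∂₂ + (1/2)(x₁ + ix₂))u = 0`. -/
def LLL (u : ℝ × ℝ → ℂ) : Prop :=
  ∀ x : ℝ × ℝ,
    fderiv ℝ u x (1, 0) + Complex.I * fderiv ℝ u x (0, 1)
      + (1/2 : ℂ) * ((x.1 : ℂ) + Complex.I * (x.2 : ℂ)) * u x = 0

/-- The Abrikosov energy `F_R(v) = ∫_{K_R} (-|v|² + (1/2)|v|⁴)`. -/
def FAb (R : ℝ) (v : ℝ × ℝ → ℂ) : ℝ :=
  ∫ x in KR R, (-‖v x‖ ^ 2 + (1/2) * ‖v x‖ ^ 4)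

/-- `c(R)`: the minimal Abrikosov energy over the lowest Landau band `L_R`. -/
def cAb (R : ℝ) : ℝ :=
  sInf {E : ℝ | ∃ u : ℝ × ℝ → ℂ, ContDiff ℝ (⊤ : ℕ∞) u ∧ MagPeriodic R u ∧ LLL u ∧ E = FAb R u}

/-- The thermodynamic limit function `g(b) = lim_{R→∞} m₀(b,R)/R²`. -/
def gfun (b : ℝ) : ℝ := limUnder atTop (fun R : ℝ => m0 b R / R ^ 2)

/-- The canonical 3D magnetic potential `F(x) = (-x₂/2, x₁/2, 0)`. -/
def Fpot (x : ℝ × ℝ × ℝ) : ℝ × ℝ × ℝ := (-x.2.1 / 2, x.1 / 2, 0)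

/-- The open cube `Q_R = (-R/2, R/2)³` in `ℝ³`. -/
def QR (R : ℝ) : Set (ℝ × ℝ × ℝ) :=
  Ioo (-R/2) (R/2) ×ˢ Ioo (-R/2) (R/2) ×ˢ Ioo (-R/2) (R/2)

/-- First component of the 3D magnetic gradient `(∇ - iF)u`. -/
def DD1 (u : ℝ × ℝ × ℝ → ℂ) (x : ℝ × ℝ × ℝ) : ℂ :=
  fderiv ℝ u x (1, 0, 0) - Complex.I * ((Fpot x).1 : ℂ) * u x

/-- Second component of the 3D magnetic gradient `(∇ - iF)u`. -/
def DD2 (u : ℝ × ℝ × ℝ → ℂ) (x : ℝ × ℝ × ℝ) : ℂ :=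
  fderiv ℝ u x (0, 1, 0) - Complex.I * ((Fpot x).2.1 : ℂ) * u x

/-- Third component of the 3D magnetic gradient `(∇ - iF)u`. -/
def DD3 (u : ℝ × ℝ × ℝ → ℂ) (x : ℝ × ℝ × ℝ) : ℂ :=
  fderiv ℝ u x (0, 0, 1) - Complex.I * ((Fpot x).2.2 : ℂ) * u x

/-- The three-dimensional Ginzburg–Landau energy `F³ᴰ_{b,Q_R}(u)`. -/
def G3 (b R : ℝ) (u : ℝ × ℝ × ℝ → ℂ) : ℝ :=
  ∫ x in QR R, (b * (‖DD1 u x‖ ^ 2 + ‖DD2 u x‖ ^ 2 + ‖DD3 u x‖ ^ 2)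
    - ‖u x‖ ^ 2 + (1/2) * ‖u x‖ ^ 4)

/-- `M₀(b,R)`: the 3D ground state energy with Dirichlet boundary conditions. -/
def M0 (b R : ℝ) : ℝ :=
  sInf {E : ℝ | ∃ u : ℝ × ℝ × ℝ → ℂ, ContDiff ℝ (⊤ : ℕ∞) u ∧ HasCompactSupport u ∧
    tsupport u ⊆ QR R ∧ E = G3 b R u}

end

/-- The annihilation operator `D₁ + i D₂`. -/
noncomputable def annih (u : ℝ × ℝ → ℂ) (x : ℝ × ℝ) : ℂ := D1 u x + Complex.I * D2 u x

/-- The phase `exp(-i A₀(y)·x)`. -/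
noncomputable def magPhase (y x : ℝ × ℝ) : ℂ :=
  Complex.exp (-(Complex.I * (((y.1 * x.2 - y.2 * x.1) / 2 : ℝ) : ℂ)))

/-- The magnetic translation `x ↦ exp(-i A₀(y)·x) u(x + y)`. -/
noncomputable def magTrans (y : ℝ × ℝ) (u : ℝ × ℝ → ℂ) (x : ℝ × ℝ) : ℂ :=
  magPhase y x * u (x + y)

lemma norm_magPhase (y x : ℝ × ℝ) : ‖magPhase y x‖ = 1 := by
  unfold magPhase
  rw [Complex.norm_exp]
  simp

lemma contDiff_magPhase (y : ℝ × ℝ) : ContDiff ℝ (⊤ : ℕ∞) (magPhase y) := by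
  unfold magPhase
  apply ContDiff.cexp
  apply ContDiff.neg
  apply contDiff_const.mul
  apply Complex.ofRealCLM.contDiff.comp
  apply ContDiff.div_const
  fun_prop

lemma contDiff_magTrans {y : ℝ × ℝ} {u : ℝ × ℝ → ℂ} (hu : ContDiff ℝ (⊤ : ℕ∞) u) :
    ContDiff ℝ (⊤ : ℕ∞) (magTrans y u) :=
  (contDiff_magPhase y).mul (hu.comp (contDiff_id.add contDiff_const))

lemma fderiv_magPhase (y x v : ℝ × ℝ) :
    fderiv ℝ (magPhase y) x v =
      -(Complex.I * (((y.1 * v.2 - y.2 * v.1) / 2 : ℝ) : ℂ)) * magPhase y x := by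
  have hl : HasFDerivAt (fun x : ℝ × ℝ => ((y.1 * x.2 - y.2 * x.1) / 2 : ℝ))
      ((y.1 / 2) • ContinuousLinearMap.snd ℝ ℝ ℝ
        - (y.2 / 2) • ContinuousLinearMap.fst ℝ ℝ ℝ) x := by
    have := ((hasFDerivAt_snd (𝕜 := ℝ) (p := x)).const_mul (y.1 / 2)).sub
      ((hasFDerivAt_fst (𝕜 := ℝ) (p := x)).const_mul (y.2 / 2))
    refine this.congr_of_eventuallyEq (Eventually.of_forall fun z => ?_)
    simp; ring
  have h1 := Complex.ofRealCLM.hasFDerivAt.comp x hl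
  have h2 := ((h1.const_mul Complex.I).neg).cexp
  have h3 : HasFDerivAt (magPhase y) _ x := h2
  rw [h3.fderiv]
  simp only [magPhase, Pi.neg_apply, Function.comp, Complex.ofRealCLM_apply, smul_apply,
    neg_apply, ContinuousLinearMap.comp_apply, sub_apply,
    ContinuousLinearMap.coe_fst', ContinuousLinearMap.coe_snd', smul_eq_mul]
  push_cast
  ring

lemma fderiv_magTrans {y x : ℝ × ℝ} {u : ℝ × ℝ → ℂ} (hu : DifferentiableAt ℝ u (x + y))
    (v : ℝ × ℝ) : fderiv ℝ (magTrans y u) x v = magPhase y x * (fderiv ℝ u (x + y) v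
      - Complex.I * (((y.1 * v.2 - y.2 * v.1) / 2 : ℝ) : ℂ) * u (x + y)) := by
  have h1 : DifferentiableAt ℝ (magPhase y) x :=
    ((contDiff_magPhase y).differentiable (by simp)) x
  have h2 : HasFDerivAt (fun z => u (z + y)) (fderiv ℝ u (x + y)) x :=
    (hasFDerivAt_comp_add_right y).2 hu.hasFDerivAt
  have h3 := h1.hasFDerivAt.mul h2
  have h4 : HasFDerivAt (magTrans y u) _ x := h3
  rw [h4.fderiv]
  simp only [add_apply, smul_apply, fderiv_magPhase,
    smul_eq_mul]
  ring

lemma D1_magTrans {y x : ℝ × ℝ} {u : ℝ × ℝ → ℂ} (hu : DifferentiableAt ℝ u (x + y)) :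
    D1 (magTrans y u) x = magPhase y x * D1 u (x + y) := by
  rw [D1, fderiv_magTrans hu, D1, magTrans]
  simp only [A0, Prod.fst_add, Prod.snd_add]
  push_cast
  ring

lemma D2_magTrans {y x : ℝ × ℝ} {u : ℝ × ℝ → ℂ} (hu : DifferentiableAt ℝ u (x + y)) :
    D2 (magTrans y u) x = magPhase y x * D2 u (x + y) := by
  rw [D2, fderiv_magTrans hu, D2, magTrans]
  simp only [A0, Prod.fst_add, Prod.snd_add]
  push_cast
  ring

lemma annih_magTrans {y x : ℝ × ℝ} {u : ℝ × ℝ → ℂ} (hu : DifferentiableAt ℝ u (x + y)) :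
    annih (magTrans y u) x = magPhase y x * annih u (x + y) := by
  rw [annih, D1_magTrans hu, D2_magTrans hu, annih]
  ring

lemma D1_const_mul {x : ℝ × ℝ} {u : ℝ × ℝ → ℂ} (hu : DifferentiableAt ℝ u x) (c : ℂ) :
    D1 (fun z => c * u z) x = c * D1 u x := by
  rw [D1, fderiv_const_mul hu, D1]
  simp; ring

lemma D2_const_mul {x : ℝ × ℝ} {u : ℝ × ℝ → ℂ} (hu : DifferentiableAt ℝ u x) (c : ℂ) :
    D2 (fun z => c * u z) x = c * D2 u x := by
  rw [D2, fderiv_const_mul hu, D2]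
  simp; ring

lemma annih_ofReal_mul {x : ℝ × ℝ} {u : ℝ × ℝ → ℂ} {χ : ℝ × ℝ → ℝ} (hu : DifferentiableAt ℝ u x)
    (hχ : DifferentiableAt ℝ χ x) :
    annih (fun z => (χ z : ℂ) * u z) x = (χ x : ℂ) * annih u x
      + ((fderiv ℝ χ x (1, 0) : ℂ) + Complex.I * (fderiv ℝ χ x (0, 1) : ℂ)) * u x := by
  have h1 := Complex.ofRealCLM.hasFDerivAt.comp x hχ.hasFDerivAt
  have h2 : HasFDerivAt (fun z => (χ z : ℂ) * u z) _ x := h1.mul hu.hasFDerivAt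
  rw [annih, D1, D2, h2.fderiv, annih, D1, D2]
  simp only [Function.comp, Complex.ofRealCLM_apply, smul_apply,
    ContinuousLinearMap.comp_apply, add_apply, smul_eq_mul]
  ring

lemma D1_congr {u v : ℝ × ℝ → ℂ} {x : ℝ × ℝ} (h : u =ᶠ[nhds x] v) : D1 u x = D1 v x := by
  rw [D1, D1, h.fderiv_eq, h.eq_of_nhds]

lemma D2_congr {u v : ℝ × ℝ → ℂ} {x : ℝ × ℝ} (h : u =ᶠ[nhds x] v) : D2 u x = D2 v x := by
  rw [D2, D2, h.fderiv_eq, h.eq_of_nhds]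

lemma annih_congr {u v : ℝ × ℝ → ℂ} {x : ℝ × ℝ} (h : u =ᶠ[nhds x] v) : annih u x = annih v x := by
  rw [annih, annih, D1_congr h, D2_congr h]

lemma annih_eq_zero_iff_LLL {u : ℝ × ℝ → ℂ} : LLL u ↔ ∀ x, annih u x = 0 := by
  have key : ∀ x : ℝ × ℝ, fderiv ℝ u x (1, 0) + Complex.I * fderiv ℝ u x (0, 1)
      + (1/2 : ℂ) * ((x.1 : ℂ) + Complex.I * (x.2 : ℂ)) * u x = annih u x := by
    intro x
    simp only [annih, D1, D2, A0]
    push_cast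
    linear_combination ((1/2 : ℂ) * x.1 * u x) * Complex.I_sq
  simp only [LLL, key]

lemma continuous_D1 {u : ℝ × ℝ → ℂ} (hu : ContDiff ℝ (⊤ : ℕ∞) u) : Continuous (D1 u) := by
  have := hu.continuous
  have h := (hu.continuous_fderiv (by simp)).clm_apply (continuous_const (y := ((1, 0) : ℝ × ℝ)))
  unfold D1 A0
  fun_prop

lemma continuous_D2 {u : ℝ × ℝ → ℂ} (hu : ContDiff ℝ (⊤ : ℕ∞) u) : Continuous (D2 u) := by
  have := hu.continuous
  have h := (hu.continuous_fderiv (by simp)).clm_apply (continuous_const (y := ((0, 1) : ℝ × ℝ)))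
  unfold D2 A0
  fun_prop

lemma continuous_annih {u : ℝ × ℝ → ℂ} (hu : ContDiff ℝ (⊤ : ℕ∞) u) : Continuous (annih u) := by
  have h1 := continuous_D1 hu
  have h2 := continuous_D2 hu
  unfold annih
  fun_prop

lemma integral_fderiv_apply_eq_zero {F : Type*} [NormedAddCommGroup F] [NormedSpace ℝ F]
    {g : ℝ × ℝ → F} (v : ℝ × ℝ)
    (hg : Differentiable ℝ g) (hi : Integrable g) (hi' : Integrable fun x => fderiv ℝ g x v) :
    ∫ x, fderiv ℝ g x v = 0 := by
  have h := integral_bilinear_hasFDerivAt_right_eq_neg_left_of_integrable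
    (μ := (volume : Measure (ℝ × ℝ)))
    (f := fun _ => (1 : ℝ)) (f' := fun _ => 0) (g := g) (g' := fderiv ℝ g) (v := v)
    (B := ContinuousLinearMap.lsmul ℝ ℝ) (by simp) (by simpa using hi')
    (by simpa using hi) (fun x _ => hasFDerivAt_const _ _) (fun x _ => (hg x).hasFDerivAt)
  simpa using h

lemma integral_fderiv_apply_eq_zero_of_hasCompactSupport {g : ℝ × ℝ → ℝ} (v : ℝ × ℝ)
    (hg : ContDiff ℝ 1 g) (hs : HasCompactSupport g) : ∫ x, fderiv ℝ g x v = 0 := by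
  refine integral_fderiv_apply_eq_zero v (hg.differentiable (by simp))
    (hg.continuous.integrable_of_hasCompactSupport hs) ?_
  refine Continuous.integrable_of_hasCompactSupport
    ((hg.continuous_fderiv (by simp)).clm_apply continuous_const) ?_
  exact hs.fderiv_apply ℝ v

/-- The energy density `κ |(D₁ + i D₂) u|² - |u|² + |u|⁴ / 2`. -/
noncomputable def energyDensity (κ : ℝ) (u : ℝ × ℝ → ℂ) (x : ℝ × ℝ) : ℝ :=
  κ * ‖annih u x‖ ^ 2 - ‖u x‖ ^ 2 + (1/2) * ‖u x‖ ^ 4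

/-- The rescaled energy on the square `KR R`. -/
noncomputable def scaledEnergy (κ R : ℝ) (u : ℝ × ℝ → ℂ) : ℝ :=
  ∫ x in KR R, energyDensity κ u x

/-- Smooth functions with compact support in the square `KR R`. -/
def IsTestFn (R : ℝ) (u : ℝ × ℝ → ℂ) : Prop :=
  ContDiff ℝ (⊤ : ℕ∞) u ∧ HasCompactSupport u ∧ tsupport u ⊆ KR R

/-- The infimum of the rescaled energy over test functions. -/
noncomputable def scaledInf (κ R : ℝ) : ℝ :=
  sInf {E : ℝ | ∃ u : ℝ × ℝ → ℂ, IsTestFn R u ∧ E = scaledEnergy κ R u}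

lemma contDiff_fderiv_apply {q : ℝ × ℝ → ℝ} (hq : ContDiff ℝ (⊤ : ℕ∞) q) (w : ℝ × ℝ) :
    ContDiff ℝ (⊤ : ℕ∞) (fun z => fderiv ℝ q z w) :=
  (hq.fderiv_right (m := (⊤ : ℕ∞)) (by simp)).clm_apply contDiff_const

lemma fderiv_fderiv_comm {q : ℝ × ℝ → ℝ} (hq : ContDiff ℝ (⊤ : ℕ∞) q) (x v w : ℝ × ℝ) :
    fderiv ℝ (fun z => fderiv ℝ q z w) x v = fderiv ℝ (fun z => fderiv ℝ q z v) x w := by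
  have hd : DifferentiableAt ℝ (fderiv ℝ q) x :=
    ((hq.fderiv_right (m := (⊤ : ℕ∞)) (by simp)).differentiable (by simp)) x
  have key : ∀ v w : ℝ × ℝ, fderiv ℝ (fun z => fderiv ℝ q z w) x v
      = fderiv ℝ (fderiv ℝ q) x v w := by
    intro v w
    rw [fderiv_clm_apply hd (differentiableAt_const w)]
    simp
  rw [key, key]
  have hs : IsSymmSndFDerivAt ℝ q x := hq.contDiffAt.isSymmSndFDerivAt
    (by simpa using WithTop.coe_le_coe.2 (le_top : (2 : ℕ∞) ≤ ⊤))
  exact hs v w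

lemma fderiv_current {p q r : ℝ × ℝ → ℝ} (hp : ContDiff ℝ (⊤ : ℕ∞) p)
    (hq : ContDiff ℝ (⊤ : ℕ∞) q) (hr : ContDiff ℝ (⊤ : ℕ∞) r) (x v w : ℝ × ℝ) :
    fderiv ℝ (fun z => q z * fderiv ℝ p z w - p z * fderiv ℝ q z w
        + r z / 2 * (p z * p z + q z * q z)) x v =
      fderiv ℝ q x v * fderiv ℝ p x w + q x * fderiv ℝ (fun z => fderiv ℝ p z w) x v
      - fderiv ℝ p x v * fderiv ℝ q x w - p x * fderiv ℝ (fun z => fderiv ℝ q z w) x v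
      + fderiv ℝ r x v / 2 * (p x * p x + q x * q x)
      + r x * (p x * fderiv ℝ p x v + q x * fderiv ℝ q x v) := by
  have dp := ((hp.differentiable (by simp)) x).hasFDerivAt
  have dq := ((hq.differentiable (by simp)) x).hasFDerivAt
  have dr := ((hr.differentiable (by simp)) x).hasFDerivAt
  have ddp := (((contDiff_fderiv_apply hp w).differentiable (by simp)) x).hasFDerivAt
  have ddq := (((contDiff_fderiv_apply hq w).differentiable (by simp)) x).hasFDerivAt
  have h := (((dq.mul ddp).sub (dp.mul ddq)).add
    ((dr.mul_const (1/2)).mul ((dp.mul dp).add (dq.mul dq))))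
  have h' : HasFDerivAt (fun z => q z * fderiv ℝ p z w - p z * fderiv ℝ q z w
        + r z / 2 * (p z * p z + q z * q z)) _ x :=
    h.congr_of_eventuallyEq (Eventually.of_forall fun z => by
      simp only [Pi.add_apply, Pi.sub_apply, Pi.mul_apply]; ring)
  rw [h'.fderiv]
  simp
  ring

lemma isBounded_KR (R : ℝ) : Bornology.IsBounded (KR R) :=
  (Metric.isBounded_Ioo _ _).prod (Metric.isBounded_Ioo _ _)

lemma isOpen_KR (R : ℝ) : IsOpen (KR R) := isOpen_Ioo.prod isOpen_Ioo

lemma measurableSet_KR (R : ℝ) : MeasurableSet (KR R) := (isOpen_KR R).measurableSet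

lemma integrableOn_KR {F : Type*} [NormedAddCommGroup F] {f : ℝ × ℝ → F} (hf : Continuous f)
    (R : ℝ) : IntegrableOn f (KR R) :=
  (hf.continuousOn.integrableOn_compact (isBounded_KR R).isCompact_closure).mono_set
    subset_closure

lemma integral_KR_sq_annih {R : ℝ} {u : ℝ × ℝ → ℂ} (hu : IsTestFn R u) :
    ∫ x in KR R, ‖annih u x‖ ^ 2 = ∫ x in KR R, (‖D1 u x‖ ^ 2 + ‖D2 u x‖ ^ 2 - ‖u x‖ ^ 2) := by
  obtain ⟨hc, hs, ht⟩ := hu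
  set p : ℝ × ℝ → ℝ := fun x => (u x).re with hp
  set q : ℝ × ℝ → ℝ := fun x => (u x).im with hq
  have cp : ContDiff ℝ (⊤ : ℕ∞) p := Complex.reCLM.contDiff.comp hc
  have cq : ContDiff ℝ (⊤ : ℕ∞) q := Complex.imCLM.contDiff.comp hc
  have hre : ∀ x v, (fderiv ℝ u x v).re = fderiv ℝ p x v := by
    intro x v
    have := (Complex.reCLM.hasFDerivAt.comp x ((hc.differentiable (by simp)) x).hasFDerivAt)
    have h2 : HasFDerivAt p _ x := this
    rw [h2.fderiv]; rfl
  have him : ∀ x v, (fderiv ℝ u x v).im = fderiv ℝ q x v := by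
    intro x v
    have := (Complex.imCLM.hasFDerivAt.comp x ((hc.differentiable (by simp)) x).hasFDerivAt)
    have h2 : HasFDerivAt q _ x := this
    rw [h2.fderiv]; rfl
  set X1 : ℝ × ℝ → ℝ := fun z => q z * fderiv ℝ p z (0, 1) - p z * fderiv ℝ q z (0, 1)
        + z.1 / 2 * (p z * p z + q z * q z) with hX1
  set X2 : ℝ × ℝ → ℝ := fun z => q z * fderiv ℝ (fun z => - p z) z (1, 0)
        - (- p z) * fderiv ℝ q z (1, 0) + z.2 / 2 * ((- p z) * (- p z) + q z * q z) with hX2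
  have cX1 : ContDiff ℝ (⊤ : ℕ∞) X1 := by
    have := contDiff_fderiv_apply cp (0, 1)
    have := contDiff_fderiv_apply cq (0, 1)
    have h3 : ContDiff ℝ (⊤ : ℕ∞) (fun z : ℝ × ℝ => z.1 / 2) := contDiff_fst.div_const 2
    exact ((cq.mul ‹_›).sub (cp.mul ‹_›)).add (h3.mul ((cp.mul cp).add (cq.mul cq)))
  have cX2 : ContDiff ℝ (⊤ : ℕ∞) X2 := by
    have := contDiff_fderiv_apply cp.neg (1, 0)
    have := contDiff_fderiv_apply cq (1, 0)
    have h3 : ContDiff ℝ (⊤ : ℕ∞) (fun z : ℝ × ℝ => z.2 / 2) := contDiff_snd.div_const 2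
    exact ((cq.mul ‹_›).sub (cp.neg.mul ‹_›)).add
      (h3.mul ((cp.neg.mul cp.neg).add (cq.mul cq)))
  have hz : ∀ x, x ∉ tsupport u → p x = 0 ∧ q x = 0 := by
    intro x hx
    have := image_eq_zero_of_notMem_tsupport hx
    simp [hp, hq, this]
  have sX1 : HasCompactSupport X1 := by
    refine HasCompactSupport.intro hs fun x hx => ?_
    obtain ⟨h1, h2⟩ := hz x hx
    simp [hX1, h1, h2]
  have sX2 : HasCompactSupport X2 := by
    refine HasCompactSupport.intro hs fun x hx => ?_
    obtain ⟨h1, h2⟩ := hz x hx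
    simp [hX2, h1, h2]
  have key : ∀ x, ‖annih u x‖ ^ 2 - (‖D1 u x‖ ^ 2 + ‖D2 u x‖ ^ 2 - ‖u x‖ ^ 2)
      = fderiv ℝ X1 x (1, 0) + fderiv ℝ X2 x (0, 1) := by
    intro x
    rw [hX1, hX2, fderiv_current cp cq contDiff_fst, fderiv_current cp.neg cq contDiff_snd]
    have e1 : fderiv ℝ (fun z : ℝ × ℝ => z.1) x (1, 0) = 1 := by
      rw [show (fun z : ℝ × ℝ => z.1) = Prod.fst from rfl, fderiv_fst]; simp
    have e2 : fderiv ℝ (fun z : ℝ × ℝ => z.2) x (0, 1) = 1 := by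
      rw [show (fun z : ℝ × ℝ => z.2) = Prod.snd from rfl, fderiv_snd]; simp
    have e3 : ∀ v, fderiv ℝ (fun z => - p z) x v = - fderiv ℝ p x v := by
      intro v; rw [fderiv_fun_neg]; simp
    have e4 : fderiv ℝ (fun z => fderiv ℝ (fun z => - p z) z (1, 0)) x (0, 1)
        = - fderiv ℝ (fun z => fderiv ℝ p z (0, 1)) x (1, 0) := by
      have : (fun z => fderiv ℝ (fun z => - p z) z (1, 0))
          = fun z => - fderiv ℝ p z (1, 0) := by
        ext z; rw [fderiv_fun_neg]; simp
      rw [this, fderiv_fun_neg, fderiv_fderiv_comm cp x (1, 0) (0, 1)]; simp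
    rw [e1, e2, e3, e3, e4, fderiv_fderiv_comm cq x (1, 0) (0, 1)]
    simp only [Complex.sq_norm, Complex.normSq_apply, annih, D1, D2, A0, Complex.add_re,
      Complex.add_im, Complex.sub_re, Complex.sub_im, Complex.mul_re, Complex.mul_im,
      Complex.I_re, Complex.I_im, Complex.ofReal_re, Complex.ofReal_im, hre, him]
    change _ = _
    simp only [hp, hq]
    ring
  have hsub : ∀ x, x ∉ KR R → ‖annih u x‖ ^ 2 - (‖D1 u x‖ ^ 2 + ‖D2 u x‖ ^ 2 - ‖u x‖ ^ 2) = 0 := by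
    intro x hx
    have hx' : x ∉ tsupport u := fun h => hx (ht h)
    have : u =ᶠ[nhds x] fun _ => 0 := notMem_tsupport_iff_eventuallyEq.1 hx'
    rw [annih_congr this, D1_congr this, D2_congr this, this.eq_of_nhds]
    simp [annih, D1, D2]
  have c1 := continuous_annih hc
  have c2 := continuous_D1 hc
  have c3 := continuous_D2 hc
  have c4 := hc.continuous
  have i1 : IntegrableOn (fun x => ‖annih u x‖ ^ 2) (KR R) := integrableOn_KR (by fun_prop) R
  have i2 : IntegrableOn (fun x => ‖D1 u x‖ ^ 2 + ‖D2 u x‖ ^ 2 - ‖u x‖ ^ 2) (KR R) :=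
    integrableOn_KR (by fun_prop) R
  rw [← sub_eq_zero, ← integral_sub i1 i2,
    setIntegral_eq_integral_of_forall_compl_eq_zero hsub]
  simp only [key]
  rw [integral_add, integral_fderiv_apply_eq_zero_of_hasCompactSupport _ (cX1.of_le (by simp)) sX1,
    integral_fderiv_apply_eq_zero_of_hasCompactSupport _ (cX2.of_le (by simp)) sX2, add_zero]
  · exact (contDiff_fderiv_apply cX1 _).continuous.integrable_of_hasCompactSupport
      (sX1.fderiv_apply ℝ _)
  · exact (contDiff_fderiv_apply cX2 _).continuous.integrable_of_hasCompactSupport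
      (sX2.fderiv_apply ℝ _)

lemma G2_eq_scaledEnergy {b R : ℝ} (hb : b < 1) {u : ℝ × ℝ → ℂ} (hu : IsTestFn R u) :
    G2 b R (fun x => (Real.sqrt (1 - b) : ℂ) * u x)
      = (1 - b) ^ 2 * scaledEnergy (b / (1 - b)) R u := by
  have hc := hu.1
  have hd : ∀ x, DifferentiableAt ℝ u x := hc.differentiable (by simp)
  have h1 : 0 < 1 - b := by linarith
  have hsq : Real.sqrt (1 - b) ^ 2 = 1 - b := Real.sq_sqrt h1.le
  have hn : ‖(Real.sqrt (1 - b) : ℂ)‖ = Real.sqrt (1 - b) := by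
    rw [Complex.norm_real, Real.norm_of_nonneg (Real.sqrt_nonneg _)]
  have h4 : Real.sqrt (1 - b) ^ 4 = (1 - b) ^ 2 := by
    rw [show (4 : ℕ) = 2 * 2 by rfl, pow_mul, hsq]
  have c1 := continuous_annih hc
  have c2 := continuous_D1 hc
  have c3 := continuous_D2 hc
  have c4 := hc.continuous
  have i1 : IntegrableOn (fun x => ‖annih u x‖ ^ 2) (KR R) := integrableOn_KR (by fun_prop) R
  have i2 : IntegrableOn (fun x => ‖D1 u x‖ ^ 2 + ‖D2 u x‖ ^ 2 - ‖u x‖ ^ 2) (KR R) :=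
    integrableOn_KR (by fun_prop) R
  have i3 : IntegrableOn (fun x => (1 - b) ^ 2 / 2 * ‖u x‖ ^ 4 - (1 - b) ^ 2 * ‖u x‖ ^ 2) (KR R) :=
    integrableOn_KR (by fun_prop) R
  have e1 : G2 b R (fun x => (Real.sqrt (1 - b) : ℂ) * u x) =
      (b * (1 - b)) * (∫ x in KR R, (‖D1 u x‖ ^ 2 + ‖D2 u x‖ ^ 2 - ‖u x‖ ^ 2))
      + ∫ x in KR R, ((1 - b) ^ 2 / 2 * ‖u x‖ ^ 4 - (1 - b) ^ 2 * ‖u x‖ ^ 2) := by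
    rw [← integral_const_mul]
    rw [← integral_add (i2.const_mul _) i3, G2]
    refine integral_congr_ae (Eventually.of_forall fun x => ?_)
    simp only [D1_const_mul (hd x), D2_const_mul (hd x), norm_mul, mul_pow, hn, hsq, h4]
    ring
  have e2 : (1 - b) ^ 2 * scaledEnergy (b / (1 - b)) R u =
      (b * (1 - b)) * (∫ x in KR R, ‖annih u x‖ ^ 2)
      + ∫ x in KR R, ((1 - b) ^ 2 / 2 * ‖u x‖ ^ 4 - (1 - b) ^ 2 * ‖u x‖ ^ 2) := by
    rw [scaledEnergy, ← integral_const_mul, ← integral_const_mul,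
      ← integral_add (i1.const_mul _) i3]
    refine integral_congr_ae (Eventually.of_forall fun x => ?_)
    simp only [energyDensity]
    field_simp
    ring
  rw [e1, e2, integral_KR_sq_annih hu]

lemma IsTestFn.const_mul {R : ℝ} {u : ℝ × ℝ → ℂ} (hu : IsTestFn R u) (c : ℂ) :
    IsTestFn R (fun x => c * u x) :=
  ⟨contDiff_const.mul hu.1, hu.2.1.mul_left (f := fun _ => c),
    (tsupport_mul_subset_right (f := fun _ => c) (g := u)).trans hu.2.2⟩

lemma m0_eq_scaledInf {b : ℝ} (hb : b < 1) (R : ℝ) :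
    m0 b R = (1 - b) ^ 2 * scaledInf (b / (1 - b)) R := by
  have h1 : 0 < 1 - b := by linarith
  rw [scaledInf, ← smul_eq_mul, ← Real.sInf_smul_of_nonneg (by positivity), m0]
  congr 1
  ext E
  simp only [mem_ofPred_eq, mem_smul_set, smul_eq_mul]
  have hne : (Real.sqrt (1 - b) : ℂ) ≠ 0 := by
    exact_mod_cast (Real.sqrt_pos.2 h1).ne'
  constructor
  · rintro ⟨u, h1, h2, h3, rfl⟩
    have hu : IsTestFn R u := ⟨h1, h2, h3⟩
    refine ⟨_, ⟨_, hu.const_mul (Real.sqrt (1 - b) : ℂ)⁻¹, rfl⟩, ?_⟩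
    rw [← G2_eq_scaledEnergy hb (hu.const_mul _)]
    congr 1
    ext x
    rw [mul_inv_cancel_left₀ hne]
  · rintro ⟨_, ⟨u, hu, rfl⟩, rfl⟩
    have h := hu.const_mul (Real.sqrt (1 - b) : ℂ)
    exact ⟨_, h.1, h.2.1, h.2.2, (G2_eq_scaledEnergy hb hu).symm⟩

/-- Functions on the plane that are `R`-periodic in both variables. -/
def DoublyPeriodic {F : Type*} (R : ℝ) (h : ℝ × ℝ → F) : Prop :=
  ∀ x : ℝ × ℝ, h (x.1 + R, x.2) = h x ∧ h (x.1, x.2 + R) = h x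

/-- Reduction of a point of the plane modulo `R` to the closed square of side `R`. -/
noncomputable def foldPt (R : ℝ) (x : ℝ × ℝ) : ℝ × ℝ :=
  (x.1 - R * round (x.1 / R), x.2 - R * round (x.2 / R))

lemma DoublyPeriodic.comp {F G : Type*} {R : ℝ} {h : ℝ × ℝ → F} (hp : DoublyPeriodic R h)
    (f : F → G) : DoublyPeriodic R (fun x => f (h x)) :=
  fun x => ⟨congrArg f (hp x).1, congrArg f (hp x).2⟩

lemma DoublyPeriodic.apply_foldPt {F : Type*} {R : ℝ} {h : ℝ × ℝ → F} (hp : DoublyPeriodic R h)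
    (x : ℝ × ℝ) : h (foldPt R x) = h x := by
  have p1 : ∀ b, Function.Periodic (fun a => h (a, b)) R := fun b a => (hp (a, b)).1
  have p2 : ∀ a, Function.Periodic (fun b => h (a, b)) R := fun a b => (hp (a, b)).2
  unfold foldPt
  have e1 := (p1 (x.2 - R * round (x.2 / R))).sub_zsmul_eq (round (x.1 / R)) (x := x.1)
  have e2 := (p2 x.1).sub_zsmul_eq (round (x.2 / R)) (x := x.2)
  simp only [zsmul_eq_mul, mul_comm _ R] at e1 e2
  rw [e1, e2]

lemma abs_sub_mul_round_le {R : ℝ} (hR : 0 < R) (a : ℝ) : |a - R * round (a / R)| ≤ R / 2 := by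
  have h := abs_sub_round (a / R)
  have : a - R * round (a / R) = R * (a / R - round (a / R)) := by field_simp
  rw [this, abs_mul, abs_of_pos hR]
  nlinarith

lemma foldPt_mem {R : ℝ} (hR : 0 < R) (x : ℝ × ℝ) :
    foldPt R x ∈ Icc (-(R / 2)) (R / 2) ×ˢ Icc (-(R / 2)) (R / 2) :=
  ⟨abs_le.1 (abs_sub_mul_round_le hR x.1), abs_le.1 (abs_sub_mul_round_le hR x.2)⟩

lemma DoublyPeriodic.exists_norm_le {F : Type*} [SeminormedAddCommGroup F] {R : ℝ} (hR : 0 < R)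
    {h : ℝ × ℝ → F} (hp : DoublyPeriodic R h) (hc : Continuous h) :
    ∃ C, ∀ x, ‖h x‖ ≤ C := by
  obtain ⟨C, hC⟩ := ((isCompact_Icc (a := -(R / 2)) (b := R / 2)).prod
    (isCompact_Icc (a := -(R / 2)) (b := R / 2))).exists_bound_of_continuousOn hc.continuousOn
  exact ⟨C, fun x => hp.apply_foldPt x ▸ hC _ (foldPt_mem hR x)⟩

lemma volume_real_KR {R : ℝ} (hR : 0 ≤ R) : (volume : Measure (ℝ × ℝ)).real (KR R) = R ^ 2 := by
  rw [KR, Measure.volume_eq_prod, measureReal_prod_prod]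
  simp only [Measure.real, Real.volume_Ioo]
  rw [ENNReal.toReal_ofReal (by linarith)]
  ring

instance (R : ℝ) : IsFiniteMeasure ((volume : Measure (ℝ × ℝ)).restrict (KR R)) :=
  ⟨by simpa using (isBounded_KR R).measure_lt_top⟩

lemma setIntegral_Ioo_comp_add {F : Type*} [NormedAddCommGroup F] [NormedSpace ℝ F] {R : ℝ}
    (hR : 0 < R) {f : ℝ → F} (hf : Function.Periodic f R) (t : ℝ) :
    ∫ x in Ioo (-R/2) (R/2), f (x + t) = ∫ x in Ioo (-R/2) (R/2), f x := by
  have hle : -R/2 ≤ R/2 := by linarith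
  rw [← integral_Ioc_eq_integral_Ioo, ← integral_Ioc_eq_integral_Ioo,
    ← intervalIntegral.integral_of_le hle, ← intervalIntegral.integral_of_le hle,
    intervalIntegral.integral_comp_add_right]
  have := hf.intervalIntegral_add_eq (-R/2 + t) (-R/2)
  convert this using 2 <;> ring

lemma DoublyPeriodic.setIntegral_comp_add {F : Type*} [NormedAddCommGroup F] [NormedSpace ℝ F]
    {R : ℝ} (hR : 0 < R) {h : ℝ × ℝ → F} (hp : DoublyPeriodic R h) (hc : Continuous h)
    (t : ℝ × ℝ) : ∫ x in KR R, h (x + t) = ∫ x in KR R, h x := by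
  have i1 := integrableOn_KR (hc.comp (continuous_id.add (continuous_const (y := t)))) R
  have i2 := integrableOn_KR hc R
  rw [KR, Measure.volume_eq_prod] at *
  have e1 := setIntegral_prod (μ := volume) (ν := volume) (fun x : ℝ × ℝ => h (x + t)) i1
  rw [e1, setIntegral_prod _ i2]
  have hper : Function.Periodic (fun a => ∫ b in Ioo (-R/2) (R/2), h (a, b)) R := by
    intro a
    exact integral_congr_ae (Eventually.of_forall fun b => (hp (a, b)).1)
  rw [← setIntegral_Ioo_comp_add hR hper t.1]
  refine integral_congr_ae (Eventually.of_forall fun a => ?_)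
  exact setIntegral_Ioo_comp_add hR (f := fun b => h (a + t.1, b)) (fun b => (hp (_, b)).2) t.2

section weighted

variable {Ω : Type*} [MeasurableSpace Ω] {μ : Measure Ω}

lemma integrable_weight_mul_comp [SFinite μ] {R : ℝ} {ρ : Ω → ℝ} (hρ : Integrable ρ μ)
    {Y : Ω → ℝ × ℝ} (hY : Measurable Y) {h : ℝ × ℝ → ℝ} (hc : Continuous h)
    {C : ℝ} (hC : ∀ x, ‖h x‖ ≤ C) :
    Integrable (fun z : (ℝ × ℝ) × Ω => ρ z.2 * h (z.1 + Y z.2))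
      ((volume.restrict (KR R)).prod μ) := by
  have h1 : Integrable (fun z : (ℝ × ℝ) × Ω => ρ z.2) ((volume.restrict (KR R)).prod μ) :=
    hρ.comp_snd _
  refine h1.mul_bdd ?_ (Eventually.of_forall fun z => hC _)
  have : Measurable fun z : (ℝ × ℝ) × Ω => z.1 + Y z.2 :=
    measurable_fst.add (hY.comp measurable_snd)
  exact (hc.measurable.comp this).aestronglyMeasurable

lemma integrable_weight_mul_comp_right {ρ : Ω → ℝ} (hρ : Integrable ρ μ)
    {Y : Ω → ℝ × ℝ} (hY : Measurable Y) {h : ℝ × ℝ → ℝ} (hc : Continuous h)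
    {C : ℝ} (hC : ∀ x, ‖h x‖ ≤ C) (x : ℝ × ℝ) :
    Integrable (fun ω => ρ ω * h (x + Y ω)) μ := by
  refine hρ.mul_bdd ?_ (Eventually.of_forall fun z => hC _)
  exact (hc.measurable.comp (hY.const_add x)).aestronglyMeasurable

lemma setIntegral_weighted [SFinite μ] {R : ℝ} (hR : 0 < R) {ρ : Ω → ℝ} (hρ : Integrable ρ μ)
    {Y : Ω → ℝ × ℝ} (hY : Measurable Y) {h : ℝ × ℝ → ℝ} (hp : DoublyPeriodic R h)
    (hc : Continuous h) :
    ∫ x in KR R, ∫ ω, ρ ω * h (x + Y ω) ∂μ = (∫ ω, ρ ω ∂μ) * ∫ x in KR R, h x := by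
  obtain ⟨C, hC⟩ := hp.exists_norm_le hR hc
  rw [integral_integral_swap (integrable_weight_mul_comp hρ hY hc hC)]
  simp only [integral_const_mul, hp.setIntegral_comp_add hR hc, integral_mul_const]

lemma sq_integral_weight_le {ρ f : Ω → ℝ} (hρ0 : ∀ ω, 0 ≤ ρ ω) (hρ : Integrable ρ μ)
    (h1 : Integrable (fun ω => ρ ω * f ω) μ) (h2 : Integrable (fun ω => ρ ω * f ω ^ 2) μ) :
    (∫ ω, ρ ω * f ω ∂μ) ^ 2 ≤ (∫ ω, ρ ω ∂μ) * ∫ ω, ρ ω * f ω ^ 2 ∂μ := by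
  have key : ∀ s : ℝ, 0 ≤ (∫ ω, ρ ω ∂μ) * (s * s) + (-2 * ∫ ω, ρ ω * f ω ∂μ) * s
      + ∫ ω, ρ ω * f ω ^ 2 ∂μ := by
    intro s
    have h0 : 0 ≤ ∫ ω, ρ ω * (f ω - s) ^ 2 ∂μ :=
      integral_nonneg fun ω => mul_nonneg (hρ0 ω) (sq_nonneg _)
    have e : ∫ ω, ρ ω * (f ω - s) ^ 2 ∂μ = ∫ ω, (ρ ω * (s * s) + (ρ ω * f ω) * (-2 * s)
        + ρ ω * f ω ^ 2) ∂μ := by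
      congr 1; ext ω; ring
    have h12 : Integrable (fun ω => ρ ω * (s * s) + (ρ ω * f ω) * (-2 * s)) μ :=
      (hρ.mul_const _).add (h1.mul_const _)
    rw [e, integral_add h12 h2,
      integral_add (hρ.mul_const _) (h1.mul_const _), integral_mul_const, integral_mul_const] at h0
    linarith
  have := discrim_le_zero key
  rw [discrim] at this
  nlinarith

lemma setIntegral_sq_le_of_le_weighted [SFinite μ] {R : ℝ} (hR : 0 < R) {ρ : Ω → ℝ}
    (hρ0 : ∀ ω, 0 ≤ ρ ω) (hρ : Integrable ρ μ) {Y : Ω → ℝ × ℝ} (hY : Measurable Y) {h w : ℝ × ℝ → ℝ}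
    (hp : DoublyPeriodic R h) (hc : Continuous h) (hw : Continuous w)
    (hle : ∀ x, |w x| ≤ ∫ ω, ρ ω * h (x + Y ω) ∂μ) :
    ∫ x in KR R, w x ^ 2 ≤ (∫ ω, ρ ω ∂μ) ^ 2 * ∫ x in KR R, h x ^ 2 := by
  have hp2 : DoublyPeriodic R (fun x => h x ^ 2) := hp.comp (· ^ 2)
  have hc2 : Continuous fun x => h x ^ 2 := hc.pow 2
  obtain ⟨C, hC⟩ := hp.exists_norm_le hR hc
  obtain ⟨C2, hC2⟩ := hp2.exists_norm_le hR hc2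
  have pt : ∀ x, w x ^ 2 ≤ (∫ ω, ρ ω ∂μ) * ∫ ω, ρ ω * h (x + Y ω) ^ 2 ∂μ := by
    intro x
    rw [← sq_abs]
    refine (pow_le_pow_left₀ (abs_nonneg _) (hle x) 2).trans ?_
    exact sq_integral_weight_le hρ0 hρ (integrable_weight_mul_comp_right hρ hY hc hC x)
      (integrable_weight_mul_comp_right hρ hY hc2 hC2 x)
  have hbound := (integrable_weight_mul_comp (R := R) hρ hY hc2 hC2).integral_prod_left
  have iw : IntegrableOn (fun x => w x ^ 2) (KR R) := integrableOn_KR (by fun_prop) R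
  calc ∫ x in KR R, w x ^ 2
      ≤ ∫ x in KR R, (∫ ω, ρ ω ∂μ) * ∫ ω, ρ ω * h (x + Y ω) ^ 2 ∂μ :=
        integral_mono iw (hbound.const_mul _) pt
    _ = _ := by
        rw [integral_const_mul, setIntegral_weighted hR hρ hY hp2 hc2]; ring

end weighted

/-- Smooth functions whose gauge-invariant quantities are `R`-periodic. -/
structure GaugePeriodic (R : ℝ) (u : ℝ × ℝ → ℂ) : Prop where
  contDiff : ContDiff ℝ (⊤ : ℕ∞) u
  norm : DoublyPeriodic R (fun x => ‖u x‖)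
  norm_annih : DoublyPeriodic R (fun x => ‖annih u x‖)
  current : DoublyPeriodic R (fun x => (starRingEnd ℂ) (u x) * annih u x)

lemma continuous_energyDensity (κ : ℝ) {u : ℝ × ℝ → ℂ} (hu : ContDiff ℝ (⊤ : ℕ∞) u) :
    Continuous (energyDensity κ u) := by
  have h1 := continuous_annih hu
  have h2 := hu.continuous
  unfold energyDensity
  fun_prop

lemma GaugePeriodic.energyDensity {R : ℝ} {u : ℝ × ℝ → ℂ} (hu : GaugePeriodic R u) (κ : ℝ) :
    DoublyPeriodic R (energyDensity κ u) := by
  intro x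
  have h1 := hu.norm x
  have h2 := hu.norm_annih x
  simp only [] at h1 h2
  simp only [_root_.energyDensity, h1.1, h1.2, h2.1, h2.2, and_self]

lemma neg_half_le_energyDensity {κ : ℝ} (hκ : 0 ≤ κ) (u : ℝ × ℝ → ℂ) (x : ℝ × ℝ) :
    -(1/2) ≤ energyDensity κ u x := by
  unfold energyDensity
  nlinarith [sq_nonneg (‖u x‖ ^ 2 - 1), mul_nonneg hκ (sq_nonneg ‖annih u x‖)]

lemma neg_le_scaledEnergy {κ : ℝ} (hκ : 0 ≤ κ) {R : ℝ} (hR : 0 ≤ R) {u : ℝ × ℝ → ℂ}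
    (hu : ContDiff ℝ (⊤ : ℕ∞) u) : -(R ^ 2 / 2) ≤ scaledEnergy κ R u := by
  have : ∫ _ in KR R, (-(1/2) : ℝ) ≤ scaledEnergy κ R u :=
    integral_mono (integrable_const _) (integrableOn_KR (continuous_energyDensity κ hu) R)
      (neg_half_le_energyDensity hκ u)
  simp only [setIntegral_const, volume_real_KR hR, smul_eq_mul] at this
  linarith

lemma bddBelow_scaledEnergy {κ : ℝ} (hκ : 0 ≤ κ) {R : ℝ} (hR : 0 ≤ R) :
    BddBelow {E : ℝ | ∃ u : ℝ × ℝ → ℂ, IsTestFn R u ∧ E = scaledEnergy κ R u} :=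
  ⟨-(R ^ 2 / 2), by rintro _ ⟨u, hu, rfl⟩; exact neg_le_scaledEnergy hκ hR hu.1⟩

lemma scaledInf_le {κ : ℝ} (hκ : 0 ≤ κ) {R : ℝ} (hR : 0 ≤ R) {u : ℝ × ℝ → ℂ}
    (hu : IsTestFn R u) : scaledInf κ R ≤ scaledEnergy κ R u :=
  csInf_le (bddBelow_scaledEnergy hκ hR) ⟨u, hu, rfl⟩

lemma norm_annih_cutoff_sq {u : ℝ × ℝ → ℂ} {χ : ℝ × ℝ → ℝ} (hu : ContDiff ℝ (⊤ : ℕ∞) u)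
    (hχ : ContDiff ℝ (⊤ : ℕ∞) χ) (y x : ℝ × ℝ) :
    ‖annih (fun z => (χ z : ℂ) * magTrans y u z) x‖ ^ 2 =
      χ x ^ 2 * ‖annih u (x + y)‖ ^ 2
      + (fderiv ℝ χ x (1, 0) ^ 2 + fderiv ℝ χ x (0, 1) ^ 2) * ‖u (x + y)‖ ^ 2
      + fderiv ℝ (fun z => χ z ^ 2) x (1, 0)
          * ((starRingEnd ℂ) (u (x + y)) * annih u (x + y)).re
      + fderiv ℝ (fun z => χ z ^ 2) x (0, 1)
          * ((starRingEnd ℂ) (u (x + y)) * annih u (x + y)).im := by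
  have hd : DifferentiableAt ℝ u (x + y) := hu.differentiable (by simp) _
  have hdχ : DifferentiableAt ℝ χ x := hχ.differentiable (by simp) _
  rw [annih_ofReal_mul ((contDiff_magTrans hu).differentiable (by simp) _) hdχ,
    annih_magTrans hd, magTrans]
  have e : ∀ v, fderiv ℝ (fun z => χ z ^ 2) x v = 2 * χ x * fderiv ℝ χ x v := by
    intro v
    rw [(hdχ.hasFDerivAt.pow 2).fderiv]
    simp
  rw [e, e, show (χ x : ℂ) * (magPhase y x * annih u (x + y))
      + ((fderiv ℝ χ x (1, 0) : ℂ) + Complex.I * (fderiv ℝ χ x (0, 1) : ℂ))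
        * (magPhase y x * u (x + y)) = magPhase y x * ((χ x : ℂ) * annih u (x + y)
      + ((fderiv ℝ χ x (1, 0) : ℂ) + Complex.I * (fderiv ℝ χ x (0, 1) : ℂ)) * u (x + y)) by ring,
    norm_mul, norm_magPhase, one_mul]
  simp only [Complex.sq_norm, Complex.normSq_apply, Complex.add_re, Complex.add_im,
    Complex.mul_re, Complex.mul_im, Complex.I_re, Complex.I_im, Complex.ofReal_re,
    Complex.ofReal_im, Complex.conj_re, Complex.conj_im]
  ring

lemma IsTestFn.cutoff {S : ℝ} {u : ℝ × ℝ → ℂ} {χ : ℝ × ℝ → ℝ} (hu : ContDiff ℝ (⊤ : ℕ∞) u)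
    (hχ : ContDiff ℝ (⊤ : ℕ∞) χ) (hs : HasCompactSupport χ) (ht : tsupport χ ⊆ KR S)
    (y : ℝ × ℝ) : IsTestFn S (fun z => (χ z : ℂ) * magTrans y u z) := by
  have hc : ContDiff ℝ (⊤ : ℕ∞) (fun z => (χ z : ℂ)) := Complex.ofRealCLM.contDiff.comp hχ
  have hsub : tsupport (fun z => (χ z : ℂ) * magTrans y u z) ⊆ tsupport χ := by
    refine closure_mono fun x hx => ?_
    simp only [Function.mem_support, ne_eq, mul_eq_zero, not_or] at hx ⊢
    exact_mod_cast hx.1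
  exact ⟨hc.mul (contDiff_magTrans hu), hs.of_isClosed_subset (isClosed_tsupport _) hsub,
    hsub.trans ht⟩

lemma scaledInf_mul_sq_le {κ : ℝ} (hκ : 0 ≤ κ) {L S : ℝ} (hL : 0 < L) (hS : 0 < S)
    {u : ℝ × ℝ → ℂ} (hu : GaugePeriodic L u) {χ : ℝ × ℝ → ℝ} (hχ : ContDiff ℝ (⊤ : ℕ∞) χ)
    (hs : HasCompactSupport χ) (ht : tsupport χ ⊆ KR S) (h01 : ∀ x, χ x ∈ Icc (0:ℝ) 1) :
    scaledInf κ S * L ^ 2 ≤ (∫ x, χ x ^ 2) * scaledEnergy κ L u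
      + κ * (∫ x, (fderiv ℝ χ x (1, 0) ^ 2 + fderiv ℝ χ x (0, 1) ^ 2))
        * ∫ x in KR L, ‖u x‖ ^ 2 := by
  have hc := hu.contDiff
  have cu := hc.continuous
  have ca := continuous_annih hc
  have ce := continuous_energyDensity κ hc
  have cχ := hχ.continuous
  have cχ2 : ContDiff ℝ (⊤ : ℕ∞) (fun z => χ z ^ 2) := hχ.pow 2
  have cd1 := (contDiff_fderiv_apply hχ (1, 0)).continuous
  have cd2 := (contDiff_fderiv_apply hχ (0, 1)).continuous
  have cs1 := (contDiff_fderiv_apply cχ2 (1, 0)).continuous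
  have cs2 := (contDiff_fderiv_apply cχ2 (0, 1)).continuous
  set q : ℝ × ℝ → ℂ := fun x => (starRingEnd ℂ) (u x) * annih u x with hq
  have cq : Continuous q := (Complex.continuous_conj.comp cu).mul ca
  have cqr : Continuous fun x => (q x).re := Complex.continuous_re.comp cq
  have cqi : Continuous fun x => (q x).im := Complex.continuous_im.comp cq
  have cn : Continuous fun x => ‖u x‖ ^ 2 := by fun_prop
  have hz : ∀ x, x ∉ tsupport χ → χ x = 0 ∧ (∀ v, fderiv ℝ χ x v = 0)
      ∧ ∀ v, fderiv ℝ (fun z => χ z ^ 2) x v = 0 := by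
    intro x hx
    have h0 : χ =ᶠ[nhds x] fun _ => 0 := notMem_tsupport_iff_eventuallyEq.1 hx
    have h2 : (fun z => χ z ^ 2) =ᶠ[nhds x] fun _ => 0 := h0.mono fun z hz => by simp [hz]
    refine ⟨h0.eq_of_nhds, fun v => ?_, fun v => ?_⟩
    · rw [h0.fderiv_eq]; simp
    · rw [h2.fderiv_eq]; simp
  have hs2 : HasCompactSupport (fun z => χ z ^ 2) :=
    HasCompactSupport.intro hs fun x hx => by simp [(hz x hx).1]
  have iρ : ∀ ρ : ℝ × ℝ → ℝ, Continuous ρ → (∀ x, x ∉ tsupport χ → ρ x = 0) → Integrable ρ :=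
    fun ρ h1 h2 => h1.integrable_of_hasCompactSupport (HasCompactSupport.intro hs h2)
  have i0 : Integrable (fun x => χ x ^ 2) := iρ _ cχ2.continuous fun x hx => by simp [(hz x hx).1]
  have i1 : Integrable (fun x => fderiv ℝ χ x (1, 0) ^ 2 + fderiv ℝ χ x (0, 1) ^ 2) :=
    iρ _ (by fun_prop) fun x hx => by simp [(hz x hx).2.1]
  have i2 := iρ _ cs1 fun x hx => (hz x hx).2.2 _
  have i3 := iρ _ cs2 fun x hx => (hz x hx).2.2 _
  have w : ∀ {ρ h : ℝ × ℝ → ℝ}, Integrable ρ → Continuous h → DoublyPeriodic L h →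
      IntegrableOn (fun y => ∫ x, ρ x * h (y + x)) (KR L) ∧
      ∫ y in KR L, ∫ x, ρ x * h (y + x) = (∫ x, ρ x) * ∫ x in KR L, h x := by
    intro ρ h iρ ch ph
    obtain ⟨C, hC⟩ := ph.exists_norm_le hL ch
    exact ⟨(integrable_weight_mul_comp iρ measurable_id ch hC).integral_prod_left,
      setIntegral_weighted hL iρ measurable_id ph ch⟩
  have w0 := w i0 ce (hu.energyDensity κ)
  have w1 := w i1 cn (hu.norm.comp (· ^ 2))
  have w2 := w i2 cqr (hu.current.comp Complex.re)
  have w3 := w i3 cqi (hu.current.comp Complex.im)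
  rw [integral_fderiv_apply_eq_zero_of_hasCompactSupport _ (cχ2.of_le (by simp)) hs2,
    zero_mul] at w2 w3
  have pt : ∀ y, scaledInf κ S ≤ (∫ x, χ x ^ 2 * energyDensity κ u (y + x))
      + κ * (∫ x, (fderiv ℝ χ x (1, 0) ^ 2 + fderiv ℝ χ x (0, 1) ^ 2) * ‖u (y + x)‖ ^ 2)
      + κ * (∫ x, fderiv ℝ (fun z => χ z ^ 2) x (1, 0) * (q (y + x)).re)
      + κ * (∫ x, fderiv ℝ (fun z => χ z ^ 2) x (0, 1) * (q (y + x)).im) := by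
    intro y
    refine (scaledInf_le hκ hS.le (IsTestFn.cutoff hc hχ hs ht y)).trans ?_
    have cadd : Continuous fun x : ℝ × ℝ => y + x := by fun_prop
    have j0 : IntegrableOn (fun x => χ x ^ 2 * energyDensity κ u (y + x)) (KR S) :=
      integrableOn_KR ((cχ.pow 2).mul (ce.comp cadd)) S
    have j1 : IntegrableOn (fun x => κ * ((fderiv ℝ χ x (1, 0) ^ 2 + fderiv ℝ χ x (0, 1) ^ 2)
        * ‖u (y + x)‖ ^ 2)) (KR S) := integrableOn_KR (by fun_prop) S
    have j2 : IntegrableOn (fun x => κ * (fderiv ℝ (fun z => χ z ^ 2) x (1, 0)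
        * (q (y + x)).re)) (KR S) :=
      integrableOn_KR (continuous_const.mul (cs1.mul (cqr.comp cadd))) S
    have j3 : IntegrableOn (fun x => κ * (fderiv ℝ (fun z => χ z ^ 2) x (0, 1)
        * (q (y + x)).im)) (KR S) :=
      integrableOn_KR (continuous_const.mul (cs2.mul (cqi.comp cadd))) S
    have hext : ∀ f : ℝ × ℝ → ℝ, (∀ x, x ∉ tsupport χ → f x = 0) →
        ∫ x, f x = ∫ x in KR S, f x := fun f hf =>
      (setIntegral_eq_integral_of_forall_compl_eq_zero fun x hx => hf x fun h => hx (ht h)).symm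
    rw [← integral_const_mul, ← integral_const_mul, ← integral_const_mul,
      hext _ fun x hx => by simp [(hz x hx).1], hext _ fun x hx => by simp [(hz x hx).2.1],
      hext _ fun x hx => by simp [(hz x hx).2.2], hext _ fun x hx => by simp [(hz x hx).2.2],
      ← integral_add j0 j1]
    have j01 : IntegrableOn (fun x => χ x ^ 2 * energyDensity κ u (y + x)
        + κ * ((fderiv ℝ χ x (1, 0) ^ 2 + fderiv ℝ χ x (0, 1) ^ 2)
        * ‖u (y + x)‖ ^ 2)) (KR S) := j0.add j1
    rw [← integral_add j01 j2]
    have j012 : IntegrableOn (fun x => χ x ^ 2 * energyDensity κ u (y + x)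
        + κ * ((fderiv ℝ χ x (1, 0) ^ 2 + fderiv ℝ χ x (0, 1) ^ 2)
        * ‖u (y + x)‖ ^ 2) + κ * (fderiv ℝ (fun z => χ z ^ 2) x (1, 0)
        * (q (y + x)).re)) (KR S) := j01.add j2
    rw [← integral_add j012 j3, scaledEnergy]
    refine integral_mono (integrableOn_KR (continuous_energyDensity κ
      (IsTestFn.cutoff hc hχ hs ht y).1) S) (j012.add j3) fun x => ?_
    simp only [energyDensity]
    rw [norm_annih_cutoff_sq hc hχ]
    simp only [norm_mul, magTrans,
      norm_magPhase, one_mul, Complex.norm_real, Real.norm_eq_abs, mul_pow, sq_abs, add_comm y x,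
      hq]
    have h4 : |χ x| ^ 4 ≤ χ x ^ 2 := by
      rw [abs_of_nonneg (h01 x).1]
      exact pow_le_pow_of_le_one (h01 x).1 (h01 x).2 (by norm_num)
    nlinarith [mul_le_mul_of_nonneg_right h4 (pow_nonneg (norm_nonneg (u (x + y))) 4)]
  have h := integral_mono (μ := volume.restrict (KR L)) (integrable_const (scaledInf κ S))
    (((w0.1.add (w1.1.const_mul κ)).add (w2.1.const_mul κ)).add (w3.1.const_mul κ)) pt
  simp only [Pi.add_apply] at h
  rw [setIntegral_const, volume_real_KR hL.le, smul_eq_mul] at h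
  have e1 : Integrable (fun y => (∫ x, χ x ^ 2 * energyDensity κ u (y + x))
      + κ * (∫ x, (fderiv ℝ χ x (1, 0) ^ 2 + fderiv ℝ χ x (0, 1) ^ 2) * ‖u (y + x)‖ ^ 2))
      (volume.restrict (KR L)) := w0.1.add (w1.1.const_mul κ)
  have e2 : Integrable (fun y => (∫ x, χ x ^ 2 * energyDensity κ u (y + x))
      + κ * (∫ x, (fderiv ℝ χ x (1, 0) ^ 2 + fderiv ℝ χ x (0, 1) ^ 2) * ‖u (y + x)‖ ^ 2)
      + κ * (∫ x, fderiv ℝ (fun z => χ z ^ 2) x (1, 0) * (q (y + x)).re))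
      (volume.restrict (KR L)) := e1.add (w2.1.const_mul κ)
  rw [integral_add e2 (w3.1.const_mul κ), integral_add e1 (w2.1.const_mul κ),
    integral_add w0.1 (w1.1.const_mul κ), integral_const_mul, integral_const_mul,
    integral_const_mul, w0.2, w1.2, w2.2, w3.2] at h
  rw [scaledEnergy]
  linarith

/-- A smooth cutoff supported in the unit square whose square has almost full mass. -/
lemma exists_cutoff {θ : ℝ} (hθ : 0 < θ) (hθ1 : θ < 1) :
    ∃ χ : ℝ × ℝ → ℝ, ContDiff ℝ (⊤ : ℕ∞) χ ∧ HasCompactSupport χ ∧ tsupport χ ⊆ KR 1 ∧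
      (∀ x, χ x ∈ Icc (0:ℝ) 1) ∧ 1 - θ ≤ ∫ x, χ x ^ 2 ∧ ∫ x, χ x ^ 2 ≤ 1 := by
  let f : ContDiffBump (0 : ℝ) := ⟨(1 - θ / 2) / 2, (1 - θ / 4) / 2, by linarith, by linarith⟩
  set χ : ℝ × ℝ → ℝ := fun x => f x.1 * f x.2 with hχ
  have hc : ContDiff ℝ (⊤ : ℕ∞) χ :=
    (f.contDiff.comp contDiff_fst).mul (f.contDiff.comp contDiff_snd)
  have hz : ∀ x, x ∉ Metric.closedBall (0 : ℝ) ((1 - θ / 4) / 2) ×ˢ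
      Metric.closedBall (0 : ℝ) ((1 - θ / 4) / 2) → χ x = 0 := by
    intro x hx
    rw [mem_prod, not_and_or] at hx
    rcases hx with h | h
    · have : f x.1 = 0 :=
        f.zero_of_le_dist (not_le.1 fun h' => h (Metric.mem_closedBall.2 h')).le
      simp [hχ, this]
    · have : f x.2 = 0 :=
        f.zero_of_le_dist (not_le.1 fun h' => h (Metric.mem_closedBall.2 h')).le
      simp [hχ, this]
  have hK := (isCompact_closedBall (0 : ℝ) ((1 - θ / 4) / 2)).prod
    (isCompact_closedBall (0 : ℝ) ((1 - θ / 4) / 2))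
  have hsub : tsupport χ ⊆ Metric.closedBall (0 : ℝ) ((1 - θ / 4) / 2) ×ˢ
      Metric.closedBall (0 : ℝ) ((1 - θ / 4) / 2) :=
    closure_minimal (fun x hx => by by_contra h; exact hx (hz x h)) hK.isClosed
  have hs : HasCompactSupport χ := HasCompactSupport.intro hK fun x hx => hz x hx
  have ht : tsupport χ ⊆ KR 1 := by
    refine hsub.trans fun x hx => ?_
    rw [mem_prod, Real.closedBall_eq_Icc] at hx
    simp only [mem_Icc] at hx
    refine ⟨⟨?_, ?_⟩, ⟨?_, ?_⟩⟩ <;> linarith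
  have h01 : ∀ x, χ x ∈ Icc (0:ℝ) 1 := fun x =>
    ⟨mul_nonneg f.nonneg f.nonneg, mul_le_one₀ f.le_one f.nonneg f.le_one⟩
  have cχ := hc.continuous
  have i2 : ∀ R, IntegrableOn (fun x => χ x ^ 2) (KR R) := integrableOn_KR (by fun_prop)
  have e1 : ∫ x, χ x ^ 2 = ∫ x in KR 1, χ x ^ 2 :=
    (setIntegral_eq_integral_of_forall_compl_eq_zero fun x hx => by
      rw [image_eq_zero_of_notMem_tsupport fun h => hx (ht h)]; simp).symm
  refine ⟨χ, hc, hs, ht, h01, ?_, ?_⟩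
  · have hsub : KR (1 - θ / 2) ⊆ KR 1 := by
      rintro x ⟨⟨h1, h2⟩, h3, h4⟩
      refine ⟨⟨?_, ?_⟩, ⟨?_, ?_⟩⟩ <;> linarith
    have h1 : ∫ x in KR (1 - θ / 2), χ x ^ 2 ≤ ∫ x in KR 1, χ x ^ 2 :=
      setIntegral_mono_set (i2 1) (Eventually.of_forall fun x => sq_nonneg _)
        (Eventually.of_forall hsub)
    have h2 : ∫ x in KR (1 - θ / 2), χ x ^ 2 = ∫ x in KR (1 - θ / 2), 1 := by
      refine setIntegral_congr_fun (measurableSet_KR _) ?_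
      rintro x ⟨⟨h1, h2⟩, h3, h4⟩
      have e1 : f x.1 = 1 := f.one_of_mem_closedBall (by
        rw [Real.closedBall_eq_Icc]; constructor <;> simp only [f] <;> linarith)
      have e2 : f x.2 = 1 := f.one_of_mem_closedBall (by
        rw [Real.closedBall_eq_Icc]; constructor <;> simp only [f] <;> linarith)
      simp [hχ, e1, e2]
    rw [h2, setIntegral_const, volume_real_KR (by linarith), smul_eq_mul] at h1
    rw [e1]
    nlinarith [sq_nonneg θ]
  · have h1 : ∫ x in KR 1, χ x ^ 2 ≤ ∫ x in KR 1, (1 : ℝ) :=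
      integral_mono (i2 1) (integrable_const _) fun x => pow_le_one₀ (h01 x).1 (h01 x).2
    rw [setIntegral_const, volume_real_KR (by norm_num), smul_eq_mul] at h1
    rw [e1]
    linarith

lemma smul_mem_KR_one {S : ℝ} (hS : 0 < S) {x : ℝ × ℝ} (hx : S⁻¹ • x ∈ KR 1) : x ∈ KR S := by
  obtain ⟨⟨h1, h2⟩, h3, h4⟩ := hx
  simp only [Prod.smul_fst, Prod.smul_snd, smul_eq_mul] at h1 h2 h3 h4
  rw [inv_mul_eq_div] at h1 h2 h3 h4
  rw [div_lt_div_iff₀ (by norm_num) hS] at h1 h3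
  rw [div_lt_div_iff₀ hS (by norm_num)] at h2 h4
  refine ⟨⟨?_, ?_⟩, ⟨?_, ?_⟩⟩ <;> linarith

lemma scaledInf_mul_sq_le_of_unit_cutoff {κ : ℝ} (hκ : 0 ≤ κ) {L S : ℝ} (hL : 0 < L) (hS : 0 < S)
    {u : ℝ × ℝ → ℂ} (hu : GaugePeriodic L u) {χ : ℝ × ℝ → ℝ} (hχ : ContDiff ℝ (⊤ : ℕ∞) χ)
    (hs : HasCompactSupport χ) (ht : tsupport χ ⊆ KR 1) (h01 : ∀ x, χ x ∈ Icc (0:ℝ) 1) :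
    scaledInf κ S * L ^ 2 ≤ S ^ 2 * (∫ x, χ x ^ 2) * scaledEnergy κ L u
      + κ * (∫ x, (fderiv ℝ χ x (1, 0) ^ 2 + fderiv ℝ χ x (0, 1) ^ 2))
        * ∫ x in KR L, ‖u x‖ ^ 2 := by
  have hc : ContDiff ℝ (⊤ : ℕ∞) (fun x : ℝ × ℝ => χ (S⁻¹ • x)) :=
    hχ.comp (contDiff_const_smul S⁻¹)
  have hs' : HasCompactSupport (fun x : ℝ × ℝ => χ (S⁻¹ • x)) :=
    hs.comp_smul (inv_ne_zero hS.ne')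
  have ht' : tsupport (fun x : ℝ × ℝ => χ (S⁻¹ • x)) ⊆ KR S := fun x hx =>
    smul_mem_KR_one hS (ht (tsupport_comp_subset_preimage χ
      (continuous_const_smul S⁻¹ : Continuous fun x : ℝ × ℝ => S⁻¹ • x) hx))
  have h := scaledInf_mul_sq_le hκ hL hS hu hc hs' ht' (fun x => h01 _)
  have e : ∀ x v, fderiv ℝ (fun x : ℝ × ℝ => χ (S⁻¹ • x)) x v = S⁻¹ * fderiv ℝ χ (S⁻¹ • x) v := by
    intro x v
    rw [fderiv_comp_smul]
    simp
  simp only [e, mul_pow, ← mul_add] at h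
  rw [integral_const_mul, Measure.integral_comp_inv_smul volume (fun x => χ x ^ 2) S,
    Measure.integral_comp_inv_smul volume
      (fun x => fderiv ℝ χ x (1, 0) ^ 2 + fderiv ℝ χ x (0, 1) ^ 2) S] at h
  simp only [Module.finrank_prod, Module.finrank_self, smul_eq_mul] at h
  norm_num at h
  rw [inv_mul_cancel_left₀ (pow_ne_zero 2 hS.ne')] at h
  exact h

/-- The magnetic phase attached to the lattice cell containing `x`. -/
noncomputable def latticePhase (R : ℝ) (x : ℝ × ℝ) : ℂ :=
  Complex.exp (Complex.I * (((R * round (x.1 / R) * x.2 - R * round (x.2 / R) * x.1) / 2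
    + R ^ 2 * round (x.1 / R) * round (x.2 / R) / 2 : ℝ) : ℂ))

/-- Magnetic periodization of a function supported in `KR R`. -/
noncomputable def periodize (R : ℝ) (v : ℝ × ℝ → ℂ) (x : ℝ × ℝ) : ℂ :=
  latticePhase R x * v (foldPt R x)

lemma norm_latticePhase (R : ℝ) (x : ℝ × ℝ) : ‖latticePhase R x‖ = 1 := by
  rw [latticePhase, mul_comm, Complex.norm_exp_ofReal_mul_I]

lemma round_add_self_div {R : ℝ} (hR : 0 < R) (a : ℝ) :
    round ((a + R) / R) = round (a / R) + 1 := by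
  rw [add_div, div_self hR.ne', round_add_one]

lemma doublyPeriodic_foldPt {R : ℝ} (hR : 0 < R) : DoublyPeriodic R (foldPt R) := by
  intro x
  simp only [foldPt, round_add_self_div hR]
  push_cast
  constructor <;> congr 1 <;> ring

lemma magPeriodic_periodize {R : ℝ} (hR : 0 < R) {N : ℕ} (hN : R ^ 2 = 2 * Real.pi * N)
    (v : ℝ × ℝ → ℂ) : MagPeriodic R (periodize R v) := by
  intro x
  have hp := doublyPeriodic_foldPt hR x
  simp only [periodize, hp.1, hp.2, ← mul_assoc]
  constructor
  · congr 1
    unfold latticePhase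
    rw [← Complex.exp_add, round_add_self_div hR]
    congr 1
    push_cast
    ring
  · congr 1
    unfold latticePhase
    rw [← Complex.exp_add, round_add_self_div hR, Complex.exp_eq_exp_iff_exists_int]
    refine ⟨round (x.1 / R) * N, ?_⟩
    have hN' : (R : ℂ) ^ 2 = 2 * Real.pi * N := by exact_mod_cast hN
    push_cast
    linear_combination Complex.I * (round (x.1 / R) : ℂ) * hN'

lemma cell_separation {R r a a₀ : ℝ} (hR : 0 < R) (hd : |a - a₀| < R / 2 - r)
    (hne : round (a / R) ≠ round (a₀ / R)) :
    r < |a - R * round (a / R)| ∧ r < |a - R * round (a₀ / R)| := by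
  have h0 := abs_sub_mul_round_le hR a₀
  have h1 := abs_sub_mul_round_le hR a
  have hbound : (1 : ℝ) ≤ |((round (a / R) - round (a₀ / R) : ℤ) : ℝ)| := by
    exact_mod_cast Int.one_le_abs (sub_ne_zero.2 hne)
  have h2 : R ≤ |R * round (a / R) - R * round (a₀ / R)| := by
    rw [← mul_sub, abs_mul, abs_of_pos hR]
    push_cast at hbound
    nlinarith
  have h3 : |a - R * round (a₀ / R)| ≤ |a - a₀| + |a₀ - R * round (a₀ / R)| := abs_sub_le _ _ _
  have h4 : |R * round (a / R) - R * round (a₀ / R)|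
      ≤ |R * round (a / R) - a| + |a - R * round (a₀ / R)| := abs_sub_le _ _ _
  rw [abs_sub_comm _ a] at h4
  constructor <;> linarith

lemma KR_eq_ball (R : ℝ) : KR R = Metric.ball (0 : ℝ × ℝ) (R / 2) := by
  rw [← Prod.mk_zero_zero, ← ball_prod_same, Real.ball_eq_Ioo, KR]
  simp [neg_div]

lemma periodize_eventuallyEq {R : ℝ} (hR : 0 < R) {v : ℝ × ℝ → ℂ} (hv : IsTestFn R v)
    (x₀ : ℝ × ℝ) : ∃ (c : ℂ) (y : ℝ × ℝ), x₀ + y = foldPt R x₀ ∧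
      c * magPhase y x₀ = latticePhase R x₀ ∧
      periodize R v =ᶠ[nhds x₀] fun x => c * magTrans y v x := by
  have hK : tsupport v ⊆ Metric.ball 0 (R / 2) := KR_eq_ball R ▸ hv.2.2
  obtain ⟨r, hr, hKr⟩ := exists_lt_subset_ball (isClosed_tsupport v) hK
  have hzero : ∀ x : ℝ × ℝ, r < |x.1| ∨ r < |x.2| → v x = 0 := by
    intro x hx
    refine image_eq_zero_of_notMem_tsupport fun h => ?_
    have := hKr h
    rw [mem_ball_zero_iff, Prod.norm_def, sup_lt_iff] at this
    simp only [Real.norm_eq_abs] at this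
    rcases hx with h | h <;> linarith [this.1, this.2]
  refine ⟨Complex.exp (Complex.I * ((R ^ 2 * round (x₀.1 / R) * round (x₀.2 / R) / 2 : ℝ) : ℂ)),
    (-(R * round (x₀.1 / R)), -(R * round (x₀.2 / R))), ?_, ?_, ?_⟩
  · simp only [foldPt]
    ext <;> simp <;> ring
  · rw [magPhase, latticePhase, ← Complex.exp_add]
    congr 1
    push_cast
    ring
  · have h1 : ∀ᶠ x in nhds x₀, |x.1 - x₀.1| < R / 2 - r ∧ |x.2 - x₀.2| < R / 2 - r := by
      filter_upwards [Metric.ball_mem_nhds x₀ (sub_pos.2 hr)] with x hx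
      rw [Metric.mem_ball, Prod.dist_eq, sup_lt_iff] at hx
      exact hx
    filter_upwards [h1] with x hx
    by_cases hm : round (x.1 / R) = round (x₀.1 / R)
    · by_cases hn : round (x.2 / R) = round (x₀.2 / R)
      · rw [periodize, magTrans, ← mul_assoc, magPhase, latticePhase, ← Complex.exp_add, foldPt,
          hm, hn]
        congr 2
        push_cast
        ring
      · have := cell_separation hR hx.2 hn
        rw [periodize, magTrans, hzero (foldPt R x) (Or.inr this.1),
          hzero (x + _) (Or.inr (by simpa [← sub_eq_add_neg] using this.2))]
        simp
    · have := cell_separation hR hx.1 hm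
      rw [periodize, magTrans, hzero (foldPt R x) (Or.inl this.1),
        hzero (x + _) (Or.inl (by simpa [← sub_eq_add_neg] using this.2))]
      simp

section periodize

variable {R : ℝ} (hR : 0 < R) {v : ℝ × ℝ → ℂ} (hv : IsTestFn R v)
include hR hv

lemma contDiff_periodize : ContDiff ℝ (⊤ : ℕ∞) (periodize R v) := by
  rw [contDiff_iff_contDiffAt]
  intro x
  obtain ⟨c, y, -, -, h⟩ := periodize_eventuallyEq hR hv x
  exact ((contDiff_const.mul (contDiff_magTrans hv.1)).contDiffAt).congr_of_eventuallyEq h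

lemma D1_periodize (x : ℝ × ℝ) :
    D1 (periodize R v) x = latticePhase R x * D1 v (foldPt R x) := by
  obtain ⟨c, y, h1, h2, h⟩ := periodize_eventuallyEq hR hv x
  rw [D1_congr h, D1_const_mul ((contDiff_magTrans hv.1).differentiable (by simp) x),
    D1_magTrans (hv.1.differentiable (by simp) _), h1, ← h2, mul_assoc]

lemma D2_periodize (x : ℝ × ℝ) :
    D2 (periodize R v) x = latticePhase R x * D2 v (foldPt R x) := by
  obtain ⟨c, y, h1, h2, h⟩ := periodize_eventuallyEq hR hv x
  rw [D2_congr h, D2_const_mul ((contDiff_magTrans hv.1).differentiable (by simp) x),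
    D2_magTrans (hv.1.differentiable (by simp) _), h1, ← h2, mul_assoc]

lemma annih_periodize (x : ℝ × ℝ) :
    annih (periodize R v) x = latticePhase R x * annih v (foldPt R x) := by
  rw [annih, D1_periodize hR hv, D2_periodize hR hv, annih]
  ring

lemma gaugePeriodic_periodize : GaugePeriodic R (periodize R v) := by
  have hp := doublyPeriodic_foldPt hR
  refine ⟨contDiff_periodize hR hv, ?_, ?_, ?_⟩
  · simp only [periodize, norm_mul, norm_latticePhase, one_mul]
    exact hp.comp fun x => ‖v x‖
  · simp only [annih_periodize hR hv, norm_mul, norm_latticePhase, one_mul]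
    exact hp.comp fun x => ‖annih v x‖
  · have e : ∀ x, (starRingEnd ℂ) (periodize R v x) * annih (periodize R v) x
        = (starRingEnd ℂ) (v (foldPt R x)) * annih v (foldPt R x) := by
      intro x
      have h1 : (starRingEnd ℂ) (latticePhase R x) * latticePhase R x = 1 := by
        rw [Complex.conj_mul', norm_latticePhase]; simp
      rw [annih_periodize hR hv, periodize, map_mul]
      linear_combination (starRingEnd ℂ) (v (foldPt R x)) * annih v (foldPt R x) * h1
    simp only [e]
    exact hp.comp fun x => (starRingEnd ℂ) (v x) * annih v x

omit hv in
lemma foldPt_eq_self {x : ℝ × ℝ} (hx : x ∈ KR R) : foldPt R x = x ∧ latticePhase R x = 1 := by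
  have key : ∀ a ∈ Ioo (-R/2) (R/2), round (a / R) = 0 := by
    rintro a ⟨h1, h2⟩
    rw [round_eq_zero_iff]
    constructor
    · rw [le_div_iff₀ hR]; linarith
    · rw [div_lt_iff₀ hR]; linarith
  unfold foldPt latticePhase
  rw [key _ hx.1, key _ hx.2]
  simp

lemma setIntegral_KR_periodize {F : Type*} [NormedAddCommGroup F] [NormedSpace ℝ F]
    (f : ℂ → ℂ → F) : ∫ x in KR R, f (periodize R v x) (annih (periodize R v) x)
      = ∫ x in KR R, f (v x) (annih v x) := by
  refine setIntegral_congr_fun (measurableSet_KR R) fun x hx => ?_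
  obtain ⟨h1, h2⟩ := foldPt_eq_self hR hx
  simp only [annih_periodize hR hv, periodize, h1, h2, one_mul]

lemma scaledEnergy_periodize (κ : ℝ) :
    scaledEnergy κ R (periodize R v) = scaledEnergy κ R v :=
  setIntegral_KR_periodize hR hv fun a b => κ * ‖b‖ ^ 2 - ‖a‖ ^ 2 + (1/2) * ‖a‖ ^ 4

end periodize

/-- The bulk energy per unit area associated with the rescaled functional. -/
noncomputable def bulkEnergy (κ : ℝ) : ℝ :=
  sInf {t : ℝ | ∃ L : ℝ, 0 < L ∧ t = scaledInf κ L / L ^ 2}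

/-- The limit of the bulk energy as the coupling `κ` tends to infinity. -/
noncomputable def limitEnergy : ℝ := ⨆ κ : ℝ, bulkEnergy (max κ 0)

lemma isTestFn_zero (R : ℝ) : IsTestFn R (fun _ => 0) := by
  refine ⟨contDiff_const, HasCompactSupport.zero, ?_⟩
  rw [show (fun _ : ℝ × ℝ => (0:ℂ)) = 0 from rfl, tsupport_zero]
  exact empty_subset _

lemma annih_zero (x : ℝ × ℝ) : annih (fun _ => 0) x = 0 := by
  simp [annih, D1, D2]

section bulk

variable {κ : ℝ} (hκ : 0 ≤ κ)
include hκ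

lemma scaledInf_nonpos {R : ℝ} (hR : 0 ≤ R) : scaledInf κ R ≤ 0 := by
  refine (scaledInf_le hκ hR (isTestFn_zero R)).trans_eq ?_
  simp [scaledEnergy, energyDensity, annih_zero]

lemma neg_le_scaledInf {R : ℝ} (hR : 0 ≤ R) : -(R ^ 2 / 2) ≤ scaledInf κ R := by
  refine le_csInf ⟨_, _, isTestFn_zero R, rfl⟩ ?_
  rintro _ ⟨u, hu, rfl⟩
  exact neg_le_scaledEnergy hκ hR hu.1

lemma neg_half_mem_lowerBounds :
    -(1/2) ∈ lowerBounds {t : ℝ | ∃ L : ℝ, 0 < L ∧ t = scaledInf κ L / L ^ 2} := by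
  rintro _ ⟨L, hL, rfl⟩
  rw [le_div_iff₀ (by positivity)]
  linarith [neg_le_scaledInf hκ hL.le]

lemma bulkEnergy_le {L : ℝ} (hL : 0 < L) : bulkEnergy κ * L ^ 2 ≤ scaledInf κ L := by
  rw [← le_div_iff₀ (by positivity)]
  exact csInf_le ⟨_, neg_half_mem_lowerBounds hκ⟩ ⟨L, hL, rfl⟩

lemma neg_half_le_bulkEnergy : -(1/2) ≤ bulkEnergy κ :=
  le_csInf ⟨_, 1, one_pos, rfl⟩ (neg_half_mem_lowerBounds hκ)

lemma bulkEnergy_nonpos : bulkEnergy κ ≤ 0 := by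
  have h := bulkEnergy_le hκ one_pos
  have := scaledInf_nonpos hκ zero_le_one
  linarith

lemma bulkEnergy_mono {κ' : ℝ} (h : κ ≤ κ') : bulkEnergy κ ≤ bulkEnergy κ' := by
  refine le_csInf ⟨_, 1, one_pos, rfl⟩ ?_
  rintro _ ⟨L, hL, rfl⟩
  rw [le_div_iff₀ (by positivity)]
  refine (bulkEnergy_le hκ hL).trans (le_csInf ⟨_, _, isTestFn_zero L, rfl⟩ ?_)
  rintro _ ⟨u, hu, rfl⟩
  refine (scaledInf_le hκ hL.le hu).trans ?_
  refine integral_mono (integrableOn_KR (continuous_energyDensity κ hu.1) L)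
    (integrableOn_KR (continuous_energyDensity κ' hu.1) L) fun x => ?_
  unfold energyDensity
  nlinarith [sq_nonneg ‖annih u x‖]

lemma bulkEnergy_mul_sq_le {L : ℝ} (hL : 0 < L) {u : ℝ × ℝ → ℂ} (hu : GaugePeriodic L u) :
    bulkEnergy κ * L ^ 2 ≤ scaledEnergy κ L u := by
  set E := scaledEnergy κ L u with hE
  suffices h : ∀ θ ∈ Ioo (0:ℝ) 1, bulkEnergy κ * L ^ 2 ≤ E + θ * |E| by
    refine le_of_forall_pos_le_add fun ε hε => ?_
    have hE1 : 0 < |E| + 1 := by positivity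
    have h2 := h (min (1/2) (ε / (|E| + 1))) ⟨by positivity, by
      exact (min_le_left _ _).trans_lt (by norm_num)⟩
    have h3 : min (1/2) (ε / (|E| + 1)) * |E| ≤ ε / (|E| + 1) * (|E| + 1) := by
      gcongr
      · exact min_le_right _ _
      · linarith
    rw [div_mul_cancel₀ _ hE1.ne'] at h3
    linarith
  rintro θ ⟨hθ, hθ1⟩
  obtain ⟨χ, hχ, hs, ht, h01, hA, hA1⟩ := exists_cutoff hθ hθ1
  set A := ∫ x, χ x ^ 2
  set B := ∫ x, (fderiv ℝ χ x (1, 0) ^ 2 + fderiv ℝ χ x (0, 1) ^ 2)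
  set M := ∫ x in KR L, ‖u x‖ ^ 2
  have key : ∀ S : ℝ, 0 < S → bulkEnergy κ * L ^ 2 ≤ A * E + κ * B * M * (S ^ 2)⁻¹ := by
    intro S hS
    have h1 := scaledInf_mul_sq_le_of_unit_cutoff hκ hL hS hu hχ hs ht h01
    have h2 := mul_le_mul_of_nonneg_right (bulkEnergy_le hκ hS) (sq_nonneg L)
    have hS2 : 0 < S ^ 2 := by positivity
    have h3 : bulkEnergy κ * L ^ 2 ≤ (S ^ 2 * A * E + κ * B * M) * (S ^ 2)⁻¹ := by
      rw [← div_eq_mul_inv, le_div_iff₀ hS2]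
      linarith
    have h4 : (S ^ 2 * A * E + κ * B * M) * (S ^ 2)⁻¹ = A * E + κ * B * M * (S ^ 2)⁻¹ := by
      field_simp
    linarith
  have lim : Tendsto (fun S : ℝ => A * E + κ * B * M * (S ^ 2)⁻¹) atTop (nhds (A * E)) := by
    have := (((tendsto_pow_atTop (α := ℝ) two_ne_zero).inv_tendsto_atTop).const_mul
      (κ * B * M)).const_add (A * E)
    simpa using this
  have hle := ge_of_tendsto lim ((eventually_gt_atTop 0).mono key)
  nlinarith [neg_abs_le E, le_abs_self E, mul_nonneg (sub_nonneg.2 hA1) (abs_nonneg E),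
    mul_nonneg (sub_nonneg.2 hA) (abs_nonneg E),
    mul_nonneg (sub_nonneg.2 hA1) (sub_nonneg.2 (neg_abs_le E))]

lemma integral_norm_sq_le {L : ℝ} (hL : 0 ≤ L) {v : ℝ × ℝ → ℂ} (hv : ContDiff ℝ (⊤ : ℕ∞) v) :
    ∫ x in KR L, ‖v x‖ ^ 2 ≤ scaledEnergy κ L v + 2 * L ^ 2 := by
  have hc := hv.continuous
  have i1 : IntegrableOn (fun x => ‖v x‖ ^ 2) (KR L) := integrableOn_KR (by fun_prop) L
  have i2 := integrableOn_KR (continuous_energyDensity κ hv) L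
  have h : ∫ x in KR L, ‖v x‖ ^ 2 ≤ ∫ x in KR L, (energyDensity κ v x + 2) := by
    refine integral_mono i1 (i2.add (integrable_const _)) fun x => ?_
    simp only [energyDensity]
    nlinarith [sq_nonneg (‖v x‖ ^ 2 - 2), mul_nonneg hκ (sq_nonneg ‖annih v x‖)]
  rw [integral_add i2 (integrable_const _), setIntegral_const, volume_real_KR hL,
    smul_eq_mul] at h
  rw [scaledEnergy]
  linarith

omit hκ in
lemma exists_testFn_le {ε : ℝ} (hε : 0 < ε) :
    ∃ L : ℝ, 0 < L ∧ ∃ v, IsTestFn L v ∧ scaledEnergy κ L v ≤ (bulkEnergy κ + ε) * L ^ 2 := by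
  obtain ⟨_, ⟨L, hL, rfl⟩, h⟩ := exists_lt_of_csInf_lt
    (⟨_, 1, one_pos, rfl⟩ : {t : ℝ | ∃ L : ℝ, 0 < L ∧ t = scaledInf κ L / L ^ 2}.Nonempty)
    (show sInf {t : ℝ | ∃ L : ℝ, 0 < L ∧ t = scaledInf κ L / L ^ 2} < bulkEnergy κ + ε from
      lt_add_of_pos_right _ hε)
  rw [div_lt_iff₀ (by positivity)] at h
  obtain ⟨_, ⟨v, hv, rfl⟩, h'⟩ := exists_lt_of_csInf_lt
    (⟨_, _, isTestFn_zero L, rfl⟩ :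
      {E : ℝ | ∃ u : ℝ × ℝ → ℂ, IsTestFn L u ∧ E = scaledEnergy κ L u}.Nonempty) h
  exact ⟨L, hL, v, hv, h'.le⟩

lemma scaledInf_le_bulkEnergy {S : ℝ} (hS : 0 < S) {χ : ℝ × ℝ → ℝ} (hχ : ContDiff ℝ (⊤ : ℕ∞) χ)
    (hs : HasCompactSupport χ) (ht : tsupport χ ⊆ KR 1) (h01 : ∀ x, χ x ∈ Icc (0:ℝ) 1) :
    scaledInf κ S ≤ S ^ 2 * (∫ x, χ x ^ 2) * bulkEnergy κ
      + 3 * κ * ∫ x, (fderiv ℝ χ x (1, 0) ^ 2 + fderiv ℝ χ x (0, 1) ^ 2) := by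
  set A := ∫ x, χ x ^ 2 with hA
  set B := ∫ x, (fderiv ℝ χ x (1, 0) ^ 2 + fderiv ℝ χ x (0, 1) ^ 2) with hB
  have hA0 : 0 ≤ A := integral_nonneg fun x => sq_nonneg _
  have hB0 : 0 ≤ B := integral_nonneg fun x => by positivity
  have key : ∀ ε ∈ Ioo (0:ℝ) 1, scaledInf κ S ≤ S ^ 2 * A * (bulkEnergy κ + ε) + 3 * κ * B := by
    rintro ε ⟨hε, hε1⟩
    obtain ⟨L, hL, v, hv, hE⟩ := exists_testFn_le hε
    have hL2 : 0 < L ^ 2 := by positivity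
    have h1 := scaledInf_mul_sq_le_of_unit_cutoff hκ hL hS (gaugePeriodic_periodize hL hv)
      hχ hs ht h01
    rw [scaledEnergy_periodize hL hv,
      setIntegral_KR_periodize hL hv (fun a _ => ‖a‖ ^ 2)] at h1
    have h2 := integral_norm_sq_le hκ hL.le hv.1
    have h3 : ∫ x in KR L, ‖v x‖ ^ 2 ≤ 3 * L ^ 2 := by
      nlinarith [bulkEnergy_nonpos hκ]
    have h4 := mul_le_mul_of_nonneg_left hE (by positivity : 0 ≤ S ^ 2 * A)
    have h5 := mul_le_mul_of_nonneg_left h3 (by positivity : 0 ≤ κ * B)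
    refine le_of_mul_le_mul_right ?_ hL2
    linarith
  have lim : Tendsto (fun ε : ℝ => S ^ 2 * A * (bulkEnergy κ + ε) + 3 * κ * B)
      (nhdsWithin 0 (Ioi 0)) (nhds (S ^ 2 * A * (bulkEnergy κ + 0) + 3 * κ * B)) := by
    refine Tendsto.mono_left (Continuous.tendsto ?_ 0) nhdsWithin_le_nhds
    fun_prop
  rw [add_zero] at lim
  exact ge_of_tendsto lim ((Ioo_mem_nhdsGT one_pos : Ioo (0:ℝ) 1 ∈ _) |> mem_of_superset <| key)

lemma tendsto_scaledInf_div_sq :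
    Tendsto (fun S : ℝ => scaledInf κ S / S ^ 2) atTop (nhds (bulkEnergy κ)) := by
  rw [tendsto_order]
  constructor
  · intro t ht
    filter_upwards [eventually_gt_atTop 0] with S hS
    refine ht.trans_le ?_
    rw [le_div_iff₀ (by positivity)]
    exact bulkEnergy_le hκ hS
  · intro t ht
    set ε := min (1/2) (t - bulkEnergy κ) with hε
    have hε0 : 0 < ε := lt_min (by norm_num) (sub_pos.2 ht)
    have hε1 : ε < 1 := (min_le_left _ _).trans_lt (by norm_num)
    have hεt : ε ≤ t - bulkEnergy κ := min_le_right _ _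
    obtain ⟨χ, hχ, hs, ht, h01, hA, hA1⟩ := exists_cutoff hε0 hε1
    set A := ∫ x, χ x ^ 2
    set B := ∫ x, (fderiv ℝ χ x (1, 0) ^ 2 + fderiv ℝ χ x (0, 1) ^ 2) with hB
    have lim : Tendsto (fun S : ℝ => A * bulkEnergy κ + 3 * κ * B * (S ^ 2)⁻¹) atTop
        (nhds (A * bulkEnergy κ)) := by
      have := (((tendsto_pow_atTop (α := ℝ) two_ne_zero).inv_tendsto_atTop).const_mul
        (3 * κ * B)).const_add (A * bulkEnergy κ)
      simpa using this
    have hlt : A * bulkEnergy κ < t := by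
      nlinarith [neg_half_le_bulkEnergy hκ, bulkEnergy_nonpos hκ]
    filter_upwards [eventually_gt_atTop 0, lim.eventually_lt_const hlt] with S hS h
    refine lt_of_le_of_lt ?_ h
    have hS2 : 0 < S ^ 2 := by positivity
    rw [div_le_iff₀ hS2, add_mul, inv_mul_cancel_right₀ hS2.ne']
    linarith [scaledInf_le_bulkEnergy hκ hS hχ hs ht h01]

end bulk

lemma gfun_eq {b : ℝ} (hb0 : 0 ≤ b) (hb : b < 1) :
    gfun b = (1 - b) ^ 2 * bulkEnergy (b / (1 - b)) := by
  refine Tendsto.limUnder_eq ?_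
  have h := (tendsto_scaledInf_div_sq (div_nonneg hb0 (sub_nonneg.2 hb.le))).const_mul
    ((1 - b) ^ 2)
  refine h.congr fun R => ?_
  rw [m0_eq_scaledInf hb, mul_div_assoc]

lemma monotone_bulkEnergy_max : Monotone fun κ : ℝ => bulkEnergy (max κ 0) :=
  fun _ _ h => bulkEnergy_mono (le_max_right _ _) (max_le_max_right 0 h)

lemma bddAbove_bulkEnergy_max : BddAbove (range fun κ : ℝ => bulkEnergy (max κ 0)) :=
  ⟨0, by rintro _ ⟨κ, rfl⟩; exact bulkEnergy_nonpos (le_max_right _ _)⟩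

lemma bulkEnergy_le_limitEnergy {κ : ℝ} (hκ : 0 ≤ κ) : bulkEnergy κ ≤ limitEnergy := by
  have := le_ciSup bddAbove_bulkEnergy_max κ
  rwa [max_eq_left hκ] at this

lemma tendsto_gfun_div_sq :
    Tendsto (fun b : ℝ => gfun b / (1 - b) ^ 2) (nhdsWithin 1 (Iio 1)) (nhds limitEnergy) := by
  have h1 : Tendsto (fun b : ℝ => b / (1 - b)) (nhdsWithin 1 (Iio 1)) atTop := by
    have hsub : Tendsto (fun b : ℝ => 1 - b) (nhdsWithin 1 (Iio 1)) (nhdsWithin 0 (Ioi 0)) := by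
      refine tendsto_nhdsWithin_iff.2 ⟨?_, ?_⟩
      · have : Tendsto (fun b : ℝ => 1 - b) (nhds 1) (nhds (1 - 1)) :=
          (continuous_const.sub continuous_id).tendsto 1
        rw [sub_self] at this
        exact this.mono_left nhdsWithin_le_nhds
      · filter_upwards [self_mem_nhdsWithin] with b hb using sub_pos.2 (mem_Iio.1 hb)
    have := (tendsto_inv_nhdsGT_zero.comp hsub)
    refine Tendsto.pos_mul_atTop one_pos (tendsto_id.mono_left nhdsWithin_le_nhds) this
  have h2 := (tendsto_atTop_ciSup monotone_bulkEnergy_max bddAbove_bulkEnergy_max).comp h1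
  refine h2.congr' ?_
  filter_upwards [Ioo_mem_nhdsLT (zero_lt_one (α := ℝ))] with b hb
  have hb1 : 0 < 1 - b := sub_pos.2 hb.2
  rw [gfun_eq hb.1.le hb.2, mul_div_cancel_left₀ _ (by positivity)]
  simp only [Function.comp]
  rw [max_eq_left (div_nonneg hb.1.le hb1.le)]

lemma MagPeriodic.norm {R : ℝ} {u : ℝ × ℝ → ℂ} (hp : MagPeriodic R u) :
    DoublyPeriodic R (fun x => ‖u x‖) := by
  intro x
  have h1 : ‖Complex.exp (Complex.I * (R * x.2 / 2))‖ = 1 := by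
    rw [mul_comm]; exact_mod_cast Complex.norm_exp_ofReal_mul_I (R * x.2 / 2)
  have h2 : ‖Complex.exp (-(Complex.I * (R * x.1 / 2)))‖ = 1 := by
    rw [← mul_neg, mul_comm]; exact_mod_cast Complex.norm_exp_ofReal_mul_I (-(R * x.1 / 2))
  simp only [(hp x).1, (hp x).2, norm_mul, h1, h2, one_mul, and_self]

lemma bulkEnergy_mul_sq_le_FAb {κ : ℝ} (hκ : 0 ≤ κ) {R : ℝ} (hR : 0 < R) {u : ℝ × ℝ → ℂ}
    (hu : ContDiff ℝ (⊤ : ℕ∞) u) (hp : MagPeriodic R u) (hl : LLL u) :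
    bulkEnergy κ * R ^ 2 ≤ FAb R u := by
  have h0 := annih_eq_zero_iff_LLL.1 hl
  have hg : GaugePeriodic R u := by
    refine ⟨hu, hp.norm, ?_, ?_⟩ <;> · simp only [h0]; intro x; simp
  refine (bulkEnergy_mul_sq_le hκ hR hg).trans_eq ?_
  simp only [scaledEnergy, energyDensity, FAb, h0]
  congr 1; ext x; simp

lemma cAb_set_nonempty (R : ℝ) : {E : ℝ | ∃ u : ℝ × ℝ → ℂ, ContDiff ℝ (⊤ : ℕ∞) u ∧
    MagPeriodic R u ∧ LLL u ∧ E = FAb R u}.Nonempty :=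
  ⟨_, fun _ => 0, contDiff_const, fun x => by simp, fun x => by simp, rfl⟩

lemma bulkEnergy_mul_sq_le_cAb {κ : ℝ} (hκ : 0 ≤ κ) {R : ℝ} (hR : 0 < R) :
    bulkEnergy κ * R ^ 2 ≤ cAb R := by
  refine le_csInf (cAb_set_nonempty R) ?_
  rintro _ ⟨u, hu, hp, hl, rfl⟩
  exact bulkEnergy_mul_sq_le_FAb hκ hR hu hp hl

lemma cAb_le {R : ℝ} (hR : 0 < R) {u : ℝ × ℝ → ℂ}
    (hu : ContDiff ℝ (⊤ : ℕ∞) u) (hp : MagPeriodic R u) (hl : LLL u) : cAb R ≤ FAb R u := by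
  refine csInf_le ⟨bulkEnergy 0 * R ^ 2, ?_⟩ ⟨u, hu, hp, hl, rfl⟩
  rintro _ ⟨u, hu, hp, hl, rfl⟩
  exact bulkEnergy_mul_sq_le_FAb le_rfl hR hu hp hl

lemma limitEnergy_mul_sq_le_cAb {R : ℝ} (hR : 0 < R) : limitEnergy * R ^ 2 ≤ cAb R := by
  have hR2 : 0 < R ^ 2 := by positivity
  rw [← le_div_iff₀ hR2]
  refine ciSup_le fun κ => ?_
  rw [le_div_iff₀ hR2]
  exact bulkEnergy_mul_sq_le_cAb (le_max_right _ _) hR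

/-- The Gaussian weight `exp(-b |y|²)` on the plane. -/
noncomputable def gaussWeight (b : ℝ) (y : ℝ × ℝ) : ℝ := Real.exp (-b * (y.1 ^ 2 + y.2 ^ 2))

/-- The identification of the plane with the complex numbers. -/
noncomputable def planeToC (y : ℝ × ℝ) : ℂ := (y.1 : ℂ) + y.2 * Complex.I

/-- The projection onto the lowest Landau band. -/
noncomputable def landauProj (u : ℝ × ℝ → ℂ) (x : ℝ × ℝ) : ℂ :=
  (1 / (2 * Real.pi) : ℝ) * ∫ y, (gaussWeight (1/4) y : ℂ) * magTrans x u y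

lemma gaussWeight_nonneg (b : ℝ) (y : ℝ × ℝ) : 0 ≤ gaussWeight b y := (Real.exp_pos _).le

lemma continuous_gaussWeight (b : ℝ) : Continuous (gaussWeight b) := by
  unfold gaussWeight; fun_prop

lemma integrable_gaussWeight {b : ℝ} (hb : 0 < b) : Integrable (gaussWeight b) := by
  have h := (integrable_exp_neg_mul_sq hb).mul_prod (integrable_exp_neg_mul_sq hb)
  rw [← Measure.volume_eq_prod] at h
  refine h.congr (Eventually.of_forall fun y => ?_)
  simp only [gaussWeight, ← Real.exp_add, mul_add]

lemma sq_norm_planeToC (y : ℝ × ℝ) : ‖planeToC y‖ ^ 2 = y.1 ^ 2 + y.2 ^ 2 := by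
  rw [Complex.sq_norm, Complex.normSq_apply]
  simp [planeToC]
  ring

lemma continuous_planeToC : Continuous planeToC := by unfold planeToC; fun_prop

/-- The Bargmann kernel. -/
noncomputable def bargmannKernel (z : ℂ) (w : ℝ × ℝ) : ℂ :=
  Complex.exp (z * (starRingEnd ℂ) (planeToC w) / 2) * (gaussWeight (1/4) w : ℂ)

lemma continuous_bargmannKernel (z : ℂ) : Continuous (bargmannKernel z) := by
  have h1 := Complex.continuous_conj.comp continuous_planeToC
  have h2 := continuous_gaussWeight (1/4)
  unfold bargmannKernel
  fun_prop

lemma norm_bargmannKernel_le {r : ℝ} {z : ℂ} (hz : ‖z‖ ≤ r) (w : ℝ × ℝ) :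
    ‖bargmannKernel z w‖ ≤ Real.exp (r ^ 2) * gaussWeight (3/16) w := by
  rw [bargmannKernel, norm_mul, Complex.norm_exp, Complex.norm_real, Real.norm_eq_abs,
    abs_of_nonneg (gaussWeight_nonneg _ _), gaussWeight, gaussWeight, ← Real.exp_add,
    ← Real.exp_add, ← sq_norm_planeToC]
  refine Real.exp_le_exp.2 ?_
  have h1 : (z * (starRingEnd ℂ) (planeToC w) / 2).re ≤ ‖z‖ * ‖planeToC w‖ / 2 := by
    refine (Complex.re_le_norm _).trans_eq ?_
    simp
  nlinarith [sq_nonneg (r - ‖planeToC w‖ / 4), norm_nonneg (planeToC w),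
    mul_le_mul_of_nonneg_right hz (norm_nonneg (planeToC w))]

lemma norm_planeToC_mul_gaussWeight_le {b c : ℝ} (h : b + 1/16 ≤ c) (w : ℝ × ℝ) :
    ‖planeToC w‖ * gaussWeight c w ≤ 4 * gaussWeight b w := by
  have h1 : ‖planeToC w‖ ≤ 4 * Real.exp ((1/16) * (w.1 ^ 2 + w.2 ^ 2)) := by
    rw [← sq_norm_planeToC]
    have := Real.add_one_le_exp ((1/16) * ‖planeToC w‖ ^ 2)
    nlinarith [sq_nonneg (‖planeToC w‖ / 2 - 1)]
  calc ‖planeToC w‖ * gaussWeight c w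
      ≤ 4 * Real.exp ((1/16) * (w.1 ^ 2 + w.2 ^ 2)) * gaussWeight c w :=
        mul_le_mul_of_nonneg_right h1 (gaussWeight_nonneg _ _)
    _ ≤ 4 * gaussWeight b w := by
        rw [mul_assoc]
        refine mul_le_mul_of_nonneg_left ?_ (by norm_num)
        rw [gaussWeight, gaussWeight, ← Real.exp_add]
        refine Real.exp_le_exp.2 ?_
        nlinarith [sq_nonneg w.1, sq_nonneg w.2]

lemma differentiable_bargmann {u : ℝ × ℝ → ℂ} (hu : Continuous u) {C : ℝ}
    (hC : ∀ x, ‖u x‖ ≤ C) :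
    Differentiable ℂ fun z => ∫ w, bargmannKernel z w * u w := by
  have hC0 : 0 ≤ C := (norm_nonneg _).trans (hC 0)
  intro z₀
  have hcont : ∀ z, Continuous fun w => bargmannKernel z w * u w := fun z =>
    (continuous_bargmannKernel z).mul hu
  have cconj : Continuous fun w => (starRingEnd ℂ) (planeToC w) :=
    Complex.continuous_conj.comp continuous_planeToC
  have h := hasDerivAt_integral_of_dominated_loc_of_deriv_le (𝕜 := ℂ) (μ := volume)
    (F := fun z w => bargmannKernel z w * u w) (x₀ := z₀) (s := Metric.ball z₀ 1)
    (F' := fun z w => (starRingEnd ℂ) (planeToC w) / 2 * (bargmannKernel z w * u w))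
    (bound := fun w => 4 * (Real.exp ((‖z₀‖ + 1) ^ 2) * C) * gaussWeight (1/8) w)
    (Metric.ball_mem_nhds _ one_pos)
    (Eventually.of_forall fun z => (hcont z).aestronglyMeasurable) ?_ ?_ ?_ ?_ ?_
  · exact h.2.differentiableAt
  · refine Integrable.mono' ((integrable_gaussWeight (b := 3/16) (by norm_num)).const_mul
      (Real.exp (‖z₀‖ ^ 2) * C)) (hcont z₀).aestronglyMeasurable
      (Eventually.of_forall fun w => ?_)
    rw [norm_mul]
    have := mul_le_mul (norm_bargmannKernel_le (z := z₀) le_rfl w) (hC w) (norm_nonneg _)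
      (mul_nonneg (Real.exp_pos _).le (gaussWeight_nonneg _ _))
    linarith
  · exact ((cconj.div_const 2).mul (hcont z₀)).aestronglyMeasurable
  · refine Eventually.of_forall fun w z hz => ?_
    have hz' : ‖z‖ ≤ ‖z₀‖ + 1 := by
      have h1 : ‖z - z₀‖ < 1 := by simpa [dist_eq_norm] using hz
      have h2 := norm_sub_norm_le z z₀
      linarith
    rw [norm_mul, norm_mul, norm_div, Complex.norm_conj]
    have h1 := mul_le_mul (norm_bargmannKernel_le hz' w) (hC w) (norm_nonneg _)
      (mul_nonneg (Real.exp_pos _).le (gaussWeight_nonneg _ _))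
    have h2 := norm_planeToC_mul_gaussWeight_le (b := 1/8) (c := 3/16) (by norm_num) w
    have h3 := mul_le_mul_of_nonneg_left h1 (norm_nonneg (planeToC w))
    have h4 := mul_le_mul_of_nonneg_left h2 (mul_nonneg (Real.exp_pos ((‖z₀‖ + 1) ^ 2)).le hC0)
    have h5 : 0 ≤ ‖planeToC w‖ * (‖bargmannKernel z w‖ * ‖u w‖) := by positivity
    simp only [Complex.norm_ofNat]
    linarith
  · exact (integrable_gaussWeight (by norm_num)).const_mul _
  · refine Eventually.of_forall fun w z _ => ?_
    have h1 : HasDerivAt (fun z : ℂ => z * (starRingEnd ℂ) (planeToC w) / 2)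
        ((starRingEnd ℂ) (planeToC w) / 2) z := by
      simpa using ((hasDerivAt_id z).mul_const ((starRingEnd ℂ) (planeToC w))).div_const 2
    have h2 := (h1.cexp.mul_const (gaussWeight (1/4) w : ℂ)).mul_const (u w)
    refine h2.congr_deriv ?_
    simp only [bargmannKernel]
    ring

lemma landauProj_eq (u : ℝ × ℝ → ℂ) (x : ℝ × ℝ) :
    landauProj u x = (gaussWeight (1/4) x : ℂ) * ((1 / (2 * Real.pi) : ℝ)
      * ∫ w, bargmannKernel (planeToC x) w * u w) := by
  rw [landauProj, mul_left_comm]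
  congr 1
  rw [← integral_const_mul, ← integral_add_right_eq_self (fun w => (gaussWeight (1/4) x : ℂ) *
      (bargmannKernel (planeToC x) w * u w)) x]
  refine integral_congr_ae (Eventually.of_forall fun y => ?_)
  simp only [magTrans, ← mul_assoc]
  congr 1
  simp only [magPhase, bargmannKernel, gaussWeight, Complex.ofReal_exp, ← Complex.exp_add]
  congr 1
  simp only [planeToC, map_add, map_mul, Complex.conj_ofReal, Complex.conj_I, Prod.fst_add,
    Prod.snd_add]
  push_cast
  linear_combination ((1/2) * ((x.2 : ℂ) * (y.2 + x.2))) * Complex.I_sq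

section landauProj

variable {u : ℝ × ℝ → ℂ} (hu : Continuous u) {C : ℝ} (hC : ∀ x, ‖u x‖ ≤ C)
include hu hC

lemma contDiff_landauProj : ContDiff ℝ (⊤ : ℕ∞) (landauProj u) := by
  have h1 : ContDiff ℝ (⊤ : ℕ∞) fun z : ℂ => ∫ w, bargmannKernel z w * u w :=
    (differentiable_bargmann hu hC).contDiff.restrict_scalars ℝ
  have h2 : ContDiff ℝ (⊤ : ℕ∞) planeToC := by
    have a1 : ContDiff ℝ (⊤ : ℕ∞) fun y : ℝ × ℝ => (y.1 : ℂ) :=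
      Complex.ofRealCLM.contDiff.comp contDiff_fst
    have a2 : ContDiff ℝ (⊤ : ℕ∞) fun y : ℝ × ℝ => (y.2 : ℂ) :=
      Complex.ofRealCLM.contDiff.comp contDiff_snd
    exact a1.add (a2.mul contDiff_const)
  have h3 : ContDiff ℝ (⊤ : ℕ∞) fun y : ℝ × ℝ => (gaussWeight (1/4) y : ℂ) := by
    have h : ContDiff ℝ (⊤ : ℕ∞) (gaussWeight (1/4)) := by
      unfold gaussWeight
      fun_prop
    exact Complex.ofRealCLM.contDiff.comp h
  rw [show landauProj u = _ from funext (landauProj_eq u)]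
  exact h3.mul (contDiff_const.mul (h1.comp h2))

lemma lll_landauProj : LLL (landauProj u) := by
  intro x
  set F : ℂ → ℂ := fun z => (1 / (2 * Real.pi) : ℝ) * ∫ w, bargmannKernel z w * u w with hF
  obtain ⟨F', hF'⟩ : ∃ F', HasDerivAt F F' (planeToC x) :=
    ⟨_, (((differentiable_bargmann hu hC) (planeToC x)).hasDerivAt.const_mul _)⟩
  have e : landauProj u = fun x => (gaussWeight (1/4) x : ℂ) * F (planeToC x) :=
    funext (landauProj_eq u)
  have l1 : ∀ v : ℝ × ℝ, HasDerivAt (fun t : ℝ => planeToC (x + t • v)) (planeToC v) 0 := by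
    intro v
    have h1 : HasDerivAt (fun t : ℝ => planeToC x + (t : ℂ) * planeToC v) (planeToC v) 0 := by
      simpa using ((Complex.ofRealCLM.hasDerivAt (x := (0:ℝ))).mul_const
        (planeToC v)).const_add (planeToC x)
    refine h1.congr_of_eventuallyEq (Eventually.of_forall fun t => ?_)
    simp [planeToC]
    ring
  have l2 : ∀ v : ℝ × ℝ, HasDerivAt (fun t : ℝ => (gaussWeight (1/4) (x + t • v) : ℂ))
      (((gaussWeight (1/4) x * (-(1/2) * (x.1 * v.1 + x.2 * v.2)) : ℝ)) : ℂ) 0 := by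
    intro v
    refine HasDerivAt.ofReal_comp ?_
    have q : ∀ a b : ℝ, HasDerivAt (fun t : ℝ => (a + t * b) ^ 2) (2 * a * b) 0 := by
      intro a b
      have h := (((hasDerivAt_id (0:ℝ)).mul_const b).const_add a).fun_pow 2
      exact h.congr_deriv (by simp)
    have h := (((q x.1 v.1).add (q x.2 v.2)).const_mul (-(1/4))).exp
    refine (h.congr_of_eventuallyEq (Eventually.of_forall fun t => ?_)).congr_deriv ?_
    · simp [gaussWeight]
    · simp [gaussWeight]
      ring
  have key : ∀ v : ℝ × ℝ, fderiv ℝ (landauProj u) x v =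
      (gaussWeight (1/4) x : ℂ) * (-(1/2) * (x.1 * v.1 + x.2 * v.2)) * F (planeToC x)
        + (gaussWeight (1/4) x : ℂ) * (F' * planeToC v) := by
    intro v
    have hd : DifferentiableAt ℝ (landauProj u) x :=
      (contDiff_landauProj hu hC).differentiable (by simp) x
    have h1 : HasDerivAt (fun t : ℝ => landauProj u (x + t • v))
        (fderiv ℝ (landauProj u) x v) 0 := by
      have hl : HasLineDerivAt ℝ (landauProj u) (fderiv ℝ (landauProj u) x v) x v :=
        hd.hasFDerivAt.hasLineDerivAt v
      exact hl
    have hF0 : HasDerivAt F F' (planeToC (x + (0:ℝ) • v)) := by simpa using hF'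
    have h2 := (l2 v).mul (hF0.comp (0:ℝ) (l1 v))
    have h3 : HasDerivAt (fun t : ℝ => landauProj u (x + t • v)) _ 0 :=
      h2.congr_of_eventuallyEq (Eventually.of_forall fun t => by rw [e]; rfl)
    rw [h1.unique h3]
    simp
  rw [key, key]
  have e2 : landauProj u x = (gaussWeight (1/4) x : ℂ) * F (planeToC x) := congrFun e x
  rw [e2]
  simp only [planeToC]
  push_cast
  linear_combination ((gaussWeight (1/4) x : ℂ) * F') * Complex.I_sq

end landauProj

lemma magPeriodic_landauProj {R : ℝ} {u : ℝ × ℝ → ℂ} (hp : MagPeriodic R u) :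
    MagPeriodic R (landauProj u) := by
  intro x
  constructor
  · simp only [landauProj]
    rw [mul_left_comm]
    congr 1
    rw [← integral_const_mul]
    refine integral_congr_ae (Eventually.of_forall fun y => ?_)
    beta_reduce
    have h := (hp (y + x)).1
    simp only [Prod.fst_add, Prod.snd_add] at h
    have e : y + (x.1 + R, x.2) = (y.1 + x.1 + R, y.2 + x.2) := by ext <;> simp; ring
    have hE : Complex.exp (-(Complex.I * ((((x.1 + R) * y.2 - x.2 * y.1) / 2 : ℝ) : ℂ)))
        * Complex.exp (Complex.I * (R * ((y.2 + x.2 : ℝ) : ℂ) / 2))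
        = Complex.exp (Complex.I * (R * x.2 / 2))
        * Complex.exp (-(Complex.I * (((x.1 * y.2 - x.2 * y.1) / 2 : ℝ) : ℂ))) := by
      rw [← Complex.exp_add, ← Complex.exp_add]
      congr 1
      push_cast
      ring
    simp only [magTrans, e, h, magPhase]
    linear_combination ((gaussWeight (1/4) y : ℂ) * u (y + x)) * hE
  · simp only [landauProj]
    rw [mul_left_comm]
    congr 1
    rw [← integral_const_mul]
    refine integral_congr_ae (Eventually.of_forall fun y => ?_)
    beta_reduce
    have h := (hp (y + x)).2
    simp only [Prod.fst_add, Prod.snd_add] at h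
    have e : y + (x.1, x.2 + R) = (y.1 + x.1, y.2 + x.2 + R) := by ext <;> simp; ring
    have hE : Complex.exp (-(Complex.I * (((x.1 * y.2 - (x.2 + R) * y.1) / 2 : ℝ) : ℂ)))
        * Complex.exp (-(Complex.I * (R * ((y.1 + x.1 : ℝ) : ℂ) / 2)))
        = Complex.exp (-(Complex.I * (R * x.1 / 2)))
        * Complex.exp (-(Complex.I * (((x.1 * y.2 - x.2 * y.1) / 2 : ℝ) : ℂ))) := by
      rw [← Complex.exp_add, ← Complex.exp_add]
      congr 1
      push_cast
      ring
    simp only [magTrans, e, h, magPhase]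
    linear_combination ((gaussWeight (1/4) y : ℂ) * u (y + x)) * hE

lemma gaussWeight_mul (b c : ℝ) (y : ℝ × ℝ) :
    gaussWeight b y * gaussWeight c y = gaussWeight (b + c) y := by
  simp only [gaussWeight, ← Real.exp_add]
  congr 1
  ring

lemma gaussWeight_anti {b c : ℝ} (h : b ≤ c) (y : ℝ × ℝ) : gaussWeight c y ≤ gaussWeight b y := by
  refine Real.exp_le_exp.2 ?_
  nlinarith [sq_nonneg y.1, sq_nonneg y.2]

lemma gaussWeight_smul (b t : ℝ) (y : ℝ × ℝ) :
    gaussWeight b (t • y) = gaussWeight (b * t ^ 2) y := by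
  simp only [gaussWeight, Prod.smul_fst, Prod.smul_snd, smul_eq_mul]
  congr 1
  ring

lemma gaussWeight_smul_le {b t : ℝ} (hb : 0 ≤ b) (ht : t ∈ Icc (0:ℝ) 1) (y : ℝ × ℝ) :
    gaussWeight (-b) (t • y) ≤ gaussWeight (-b) y := by
  rw [gaussWeight_smul]
  refine gaussWeight_anti ?_ y
  have : t ^ 2 ≤ 1 := pow_le_one₀ ht.1 ht.2
  nlinarith

lemma contDiff_gaussWeight (b : ℝ) : ContDiff ℝ (⊤ : ℕ∞) (gaussWeight b) := by
  unfold gaussWeight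
  fun_prop

lemma fderiv_gaussWeight (b : ℝ) (y v : ℝ × ℝ) :
    fderiv ℝ (gaussWeight b) y v = -2 * b * (y.1 * v.1 + y.2 * v.2) * gaussWeight b y := by
  have h1 : HasFDerivAt (fun y : ℝ × ℝ => y.1) (ContinuousLinearMap.fst ℝ ℝ ℝ) y := hasFDerivAt_fst
  have h2 : HasFDerivAt (fun y : ℝ × ℝ => y.2) (ContinuousLinearMap.snd ℝ ℝ ℝ) y := hasFDerivAt_snd
  have h : HasFDerivAt (gaussWeight b) _ y :=
    ((((h1.pow 2).add (h2.pow 2)).const_mul (-b))).exp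
  rw [h.fderiv]
  simp [gaussWeight]
  ring

lemma abs_fst_le_norm_planeToC (y : ℝ × ℝ) : |y.1| ≤ ‖planeToC y‖ := by
  refine abs_le_of_sq_le_sq ?_ (norm_nonneg _)
  nlinarith [sq_norm_planeToC y, sq_nonneg y.2]

lemma abs_snd_le_norm_planeToC (y : ℝ × ℝ) : |y.2| ≤ ‖planeToC y‖ := by
  refine abs_le_of_sq_le_sq ?_ (norm_nonneg _)
  nlinarith [sq_norm_planeToC y, sq_nonneg y.1]

lemma integral_gaussWeight {b : ℝ} (hb : 0 < b) : ∫ y, gaussWeight b y = Real.pi / b := by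
  have h : ∀ y : ℝ × ℝ, gaussWeight b y = Real.exp (-b * y.1 ^ 2) * Real.exp (-b * y.2 ^ 2) := by
    intro y
    rw [gaussWeight, ← Real.exp_add, mul_add]
  simp only [h]
  rw [Measure.volume_eq_prod, integral_prod_mul (fun x : ℝ => Real.exp (-b * x ^ 2))
    (fun x : ℝ => Real.exp (-b * x ^ 2)), integral_gaussian, ← sq, Real.sq_sqrt]
  positivity

lemma integrable_smul_comp_smul {a : ℝ × ℝ → ℝ} {g : ℝ × ℝ → ℂ} (ha : Continuous a)
    (hg : Continuous g) {K C : ℝ} (hK : ∀ y, |a y| ≤ K * gaussWeight (3/8) y)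
    (hC : ∀ y, ‖g y‖ ≤ C * gaussWeight (-(5/16)) y) {t : ℝ} (ht : t ∈ Icc (0:ℝ) 1) :
    Integrable fun y => a y • g (t • y) := by
  have hC0 : 0 ≤ C := by simpa [gaussWeight] using (norm_nonneg _).trans (hC 0)
  have hcont : Continuous fun y => a y • g (t • y) := by fun_prop
  refine Integrable.mono' ((integrable_gaussWeight (b := 1/16) (by norm_num)).const_mul (K * C))
    hcont.aestronglyMeasurable (Eventually.of_forall fun y => ?_)
  have e1 := (hC (t • y)).trans
    (mul_le_mul_of_nonneg_left (gaussWeight_smul_le (b := 5/16) (by norm_num) ht y) hC0)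
  rw [norm_smul, Real.norm_eq_abs]
  refine (mul_le_mul (hK y) e1 (norm_nonneg _) ((abs_nonneg _).trans (hK y))).trans_eq ?_
  rw [mul_mul_mul_comm, gaussWeight_mul]
  norm_num

lemma integral_smul_fderiv_comp_smul {a : ℝ × ℝ → ℝ} {f : ℝ × ℝ → ℂ}
    (ha : ContDiff ℝ (⊤ : ℕ∞) a) (hf : ContDiff ℝ (⊤ : ℕ∞) f) (v : ℝ × ℝ) {K C : ℝ}
    (hK : ∀ y, |a y| ≤ K * gaussWeight (3/8) y)
    (hK' : ∀ y, |fderiv ℝ a y v| ≤ K * gaussWeight (3/8) y)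
    (hC : ∀ y, ‖f y‖ ≤ C * gaussWeight (-(5/16)) y)
    (hC' : ∀ y, ‖fderiv ℝ f y v‖ ≤ C * gaussWeight (-(5/16)) y)
    {t : ℝ} (ht : t ∈ Icc (0:ℝ) 1) :
    t • ∫ y, a y • fderiv ℝ f (t • y) v = - ∫ y, fderiv ℝ a y v • f (t • y) := by
  have da : Differentiable ℝ a := ha.differentiable (by simp)
  have df : Differentiable ℝ f := hf.differentiable (by simp)
  have ca : Continuous fun y => fderiv ℝ a y v := (contDiff_fderiv_apply ha v).continuous
  have cf : Continuous fun y => fderiv ℝ f y v :=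
    (hf.continuous_fderiv (by simp)).clm_apply continuous_const
  have i1 := integrable_smul_comp_smul ha.continuous cf hK hC' ht
  have i2 := integrable_smul_comp_smul ca hf.continuous hK' hC ht
  have dft : Differentiable ℝ fun y => f (t • y) := df.comp (differentiable_id.const_smul t)
  have e : (fun y => fderiv ℝ (fun y => a y • f (t • y)) y v) =
      fun y => t • (a y • fderiv ℝ f (t • y) v) + fderiv ℝ a y v • f (t • y) := by
    ext y
    rw [fderiv_fun_smul (da y) (dft y), fderiv_comp_smul]
    simp
    ring
  have i3 : Integrable fun y => t • (a y • fderiv ℝ f (t • y) v) := i1.smul t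
  have h := integral_fderiv_apply_eq_zero (g := fun y => a y • f (t • y)) v (da.smul dft)
    (integrable_smul_comp_smul ha.continuous hf.continuous hK hC ht)
    (by rw [e]; exact i3.add i2)
  rw [e, integral_add i3 i2, integral_smul] at h
  exact eq_neg_of_add_eq_zero_left h

lemma norm_planeToC_mul_half_le (y : ℝ × ℝ) :
    ‖planeToC y‖ * gaussWeight (1/2) y ≤ 16 * gaussWeight (3/8) y := by
  have h1 := norm_planeToC_mul_gaussWeight_le (b := 3/8) (c := 1/2) (by norm_num) y
  linarith [gaussWeight_nonneg (3/8) y]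

lemma norm_planeToC_sq_mul_half_le (y : ℝ × ℝ) :
    ‖planeToC y‖ ^ 2 * gaussWeight (1/2) y ≤ 16 * gaussWeight (3/8) y := by
  have h1 := norm_planeToC_mul_gaussWeight_le (b := 3/8) (c := 7/16) (by norm_num) y
  have h2 := norm_planeToC_mul_gaussWeight_le (b := 7/16) (c := 1/2) (by norm_num) y
  nlinarith [norm_nonneg (planeToC y)]

section meanValue

variable {f : ℝ × ℝ → ℂ} (hf : ContDiff ℝ (⊤ : ℕ∞) f) {C : ℝ}
  (h0 : ∀ z, ‖f z‖ ≤ C * gaussWeight (-(5/16)) z)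
  (h1 : ∀ z, ‖fderiv ℝ f z (1, 0)‖ ≤ C * gaussWeight (-(5/16)) z)
  (h2 : ∀ z, ‖fderiv ℝ f z (0, 1)‖ ≤ C * gaussWeight (-(5/16)) z)

include hf h0 h1 h2

lemma integral_gauss_angular_eq {t : ℝ} (ht : t ∈ Ioc (0:ℝ) 1) :
    ∫ y, (y.1 * gaussWeight (1/2) y) • fderiv ℝ f (t • y) (0, 1) =
      ∫ y, (y.2 * gaussWeight (1/2) y) • fderiv ℝ f (t • y) (1, 0) := by
  have ht' : t ∈ Icc (0:ℝ) 1 := ⟨ht.1.le, ht.2⟩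
  have g := contDiff_gaussWeight (1/2)
  have dg : Differentiable ℝ (gaussWeight (1/2)) := g.differentiable (by simp)
  have b1 : ∀ y : ℝ × ℝ, |y.1 * gaussWeight (1/2) y| ≤ 16 * gaussWeight (3/8) y := fun y => by
    rw [abs_mul, abs_of_nonneg (gaussWeight_nonneg _ _)]
    exact (mul_le_mul_of_nonneg_right (abs_fst_le_norm_planeToC y)
      (gaussWeight_nonneg _ _)).trans (norm_planeToC_mul_half_le y)
  have b2 : ∀ y : ℝ × ℝ, |y.2 * gaussWeight (1/2) y| ≤ 16 * gaussWeight (3/8) y := fun y => by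
    rw [abs_mul, abs_of_nonneg (gaussWeight_nonneg _ _)]
    exact (mul_le_mul_of_nonneg_right (abs_snd_le_norm_planeToC y)
      (gaussWeight_nonneg _ _)).trans (norm_planeToC_mul_half_le y)
  have e1 : ∀ y : ℝ × ℝ, fderiv ℝ (fun y : ℝ × ℝ => y.1 * gaussWeight (1/2) y) y (0, 1) =
      -(y.1 * y.2 * gaussWeight (1/2) y) := fun y => by
    rw [fderiv_fun_mul differentiableAt_fst (dg y)]
    simp only [add_apply, smul_apply, fderiv_gaussWeight, fderiv_fst, ContinuousLinearMap.coe_fst',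
      smul_eq_mul]
    ring
  have e2 : ∀ y : ℝ × ℝ, fderiv ℝ (fun y : ℝ × ℝ => y.2 * gaussWeight (1/2) y) y (1, 0) =
      -(y.1 * y.2 * gaussWeight (1/2) y) := fun y => by
    rw [fderiv_fun_mul differentiableAt_snd (dg y)]
    simp only [add_apply, smul_apply, fderiv_gaussWeight, fderiv_snd, ContinuousLinearMap.coe_snd',
      smul_eq_mul]
    ring
  have b3 : ∀ y : ℝ × ℝ, |-(y.1 * y.2 * gaussWeight (1/2) y)| ≤ 16 * gaussWeight (3/8) y :=
    fun y => by
      rw [abs_neg, abs_mul, abs_mul, abs_of_nonneg (gaussWeight_nonneg _ _)]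
      refine le_trans (mul_le_mul_of_nonneg_right ?_ (gaussWeight_nonneg _ _))
        (norm_planeToC_sq_mul_half_le y)
      rw [sq]
      exact mul_le_mul (abs_fst_le_norm_planeToC y) (abs_snd_le_norm_planeToC y) (abs_nonneg _)
        (norm_nonneg _)
  have r1 := integral_smul_fderiv_comp_smul (contDiff_fst.mul g) hf (0, 1) b1
    (fun y => by rw [e1]; exact b3 y) h0 h2 ht'
  have r2 := integral_smul_fderiv_comp_smul (contDiff_snd.mul g) hf (1, 0) b2
    (fun y => by rw [e2]; exact b3 y) h0 h1 ht'
  simp only [e1] at r1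
  simp only [e2] at r2
  exact smul_right_injective ℂ ht.1.ne' (r1.trans r2.symm)

end meanValue

/-- The product of the Lebesgue measures on the plane and on `(0, 1]`. -/
noncomputable def rayMeasure : Measure ((ℝ × ℝ) × ℝ) :=
  (volume : Measure (ℝ × ℝ)).prod (volume.restrict (Ioc (0:ℝ) 1))

instance : SFinite rayMeasure := by unfold rayMeasure; infer_instance

lemma ae_rayMeasure : ∀ᵐ ω ∂rayMeasure, ω.2 ∈ Ioc (0:ℝ) 1 := by
  have h : ∀ᵐ t ∂(volume.restrict (Ioc (0:ℝ) 1)), t ∈ Ioc (0:ℝ) 1 :=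
    ae_restrict_mem measurableSet_Ioc
  exact Measure.quasiMeasurePreserving_snd.ae h

section meanValue

variable {f : ℝ × ℝ → ℂ} (hf : ContDiff ℝ (⊤ : ℕ∞) f) {C : ℝ}
  (h0 : ∀ z, ‖f z‖ ≤ C * gaussWeight (-(5/16)) z)
  (h1 : ∀ z, ‖fderiv ℝ f z (1, 0)‖ ≤ C * gaussWeight (-(5/16)) z)
  (h2 : ∀ z, ‖fderiv ℝ f z (0, 1)‖ ≤ C * gaussWeight (-(5/16)) z)

lemma integrable_rayMeasure {g : (ℝ × ℝ) × ℝ → ℂ} (hg : Continuous g) {K : ℝ}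
    (h : ∀ y, ∀ t ∈ Ioc (0:ℝ) 1, ‖g (y, t)‖ ≤ K * gaussWeight (1/16) y) :
    Integrable g rayMeasure := by
  have i : Integrable (fun ω : (ℝ × ℝ) × ℝ => K * gaussWeight (1/16) ω.1) rayMeasure :=
    ((integrable_gaussWeight (b := 1/16) (by norm_num)).const_mul K).comp_fst _
  refine i.mono' hg.aestronglyMeasurable ?_
  filter_upwards [ae_rayMeasure] with ω hω using h ω.1 ω.2 hω

include hf h0 h1 h2

lemma mean_value_identity :
    (2 * Real.pi) • f 0 - ∫ y, gaussWeight (1/2) y • f y =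
      - ∫ ω, (gaussWeight (1/2) ω.1 : ℂ) * (starRingEnd ℂ) (planeToC ω.1) *
        (fderiv ℝ f (ω.2 • ω.1) (1, 0) + Complex.I * fderiv ℝ f (ω.2 • ω.1) (0, 1))
        ∂rayMeasure := by
  have df : Differentiable ℝ f := hf.differentiable (by simp)
  have hC0 : 0 ≤ C := by simpa [gaussWeight] using (norm_nonneg _).trans (h0 0)
  have cg := continuous_gaussWeight (1/2)
  have cp : Continuous fun y => (starRingEnd ℂ) (planeToC y) :=
    Complex.continuous_conj.comp continuous_planeToC
  have cf : ∀ v, Continuous fun y => fderiv ℝ f y v := fun v =>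
    (hf.continuous_fderiv (by simp)).clm_apply continuous_const
  have cf1 := cf (1, 0)
  have cf2 := cf (0, 1)
  have hlin : ∀ z y : ℝ × ℝ, fderiv ℝ f z y =
      y.1 • fderiv ℝ f z (1, 0) + y.2 • fderiv ℝ f z (0, 1) := by
    intro z y
    rw [← map_smul, ← map_smul, ← map_add]
    congr 1
    ext <;> simp
  have hb : ∀ (l : ℝ × ℝ → ℝ) (g : ℝ × ℝ → ℂ), (∀ y, |l y| ≤ ‖planeToC y‖) →
      (∀ y, ‖g y‖ ≤ C * gaussWeight (-(5/16)) y) → ∀ y, ∀ t ∈ Ioc (0:ℝ) 1,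
      ‖(l y * gaussWeight (1/2) y) • g (t • y)‖ ≤ (16 * C) * gaussWeight (1/16) y := by
    intro l g hl hg y t ht
    have e1 := (hg (t • y)).trans (mul_le_mul_of_nonneg_left
      (gaussWeight_smul_le (b := 5/16) (by norm_num) ⟨ht.1.le, ht.2⟩ y) hC0)
    rw [norm_smul, Real.norm_eq_abs, abs_mul, abs_of_nonneg (gaussWeight_nonneg _ _)]
    have e2 := (mul_le_mul_of_nonneg_right (hl y) (gaussWeight_nonneg (1/2) y)).trans
      (norm_planeToC_mul_half_le y)
    refine (mul_le_mul e2 e1 (norm_nonneg _)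
      (mul_nonneg (by norm_num) (gaussWeight_nonneg _ _))).trans_eq ?_
    rw [mul_mul_mul_comm, gaussWeight_mul]
    norm_num
  have int : ∀ (l : ℝ × ℝ → ℝ) (g : ℝ × ℝ → ℂ), Continuous l → Continuous g →
      (∀ y, |l y| ≤ ‖planeToC y‖) → (∀ y, ‖g y‖ ≤ C * gaussWeight (-(5/16)) y) →
      Integrable (fun ω : (ℝ × ℝ) × ℝ => (l ω.1 * gaussWeight (1/2) ω.1) • g (ω.2 • ω.1))
        rayMeasure := by
    intro l g cl cg hl hg
    exact integrable_rayMeasure (by fun_prop) (hb l g hl hg)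
  have i11 := int _ _ continuous_fst cf1 abs_fst_le_norm_planeToC h1
  have i12 := int _ _ continuous_fst cf2 abs_fst_le_norm_planeToC h2
  have i21 := int _ _ continuous_snd cf1 abs_snd_le_norm_planeToC h1
  have i22 := int _ _ continuous_snd cf2 abs_snd_le_norm_planeToC h2
  have hang : ∫ ω, ((ω.1.1 * gaussWeight (1/2) ω.1) • fderiv ℝ f (ω.2 • ω.1) (0, 1) -
      (ω.1.2 * gaussWeight (1/2) ω.1) • fderiv ℝ f (ω.2 • ω.1) (1, 0)) ∂rayMeasure = 0 := by
    rw [integral_sub i12 i21]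
    unfold rayMeasure at i12 i21 ⊢
    rw [integral_prod_symm _ i12, integral_prod_symm _ i21, sub_eq_zero]
    refine setIntegral_congr_fun measurableSet_Ioc fun t ht => ?_
    exact integral_gauss_angular_eq hf h0 h1 h2 ht
  have hray : ∫ y, gaussWeight (1/2) y • (f y - f 0) =
      ∫ ω, ((ω.1.1 * gaussWeight (1/2) ω.1) • fderiv ℝ f (ω.2 • ω.1) (1, 0) +
      (ω.1.2 * gaussWeight (1/2) ω.1) • fderiv ℝ f (ω.2 • ω.1) (0, 1)) ∂rayMeasure := by
    have i : Integrable _ rayMeasure := i11.add i22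
    unfold rayMeasure at i ⊢
    refine Eq.trans ?_ (integral_prod _ i).symm
    refine integral_congr_ae (Eventually.of_forall fun y => ?_)
    have hd : ∀ t : ℝ, HasDerivAt (fun t : ℝ => f (t • y)) (fderiv ℝ f (t • y) y) t := by
      intro t
      have h1 : HasDerivAt (fun t : ℝ => t • y) y t := by
        simpa using (hasDerivAt_id t).smul_const y
      exact (df (t • y)).hasFDerivAt.comp_hasDerivAt t h1
    have hc : Continuous fun t : ℝ => fderiv ℝ f (t • y) y := by
      have := cf y
      fun_prop
    have h := intervalIntegral.integral_eq_sub_of_hasDerivAt (a := 0) (b := 1)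
      (fun t _ => hd t) (hc.intervalIntegrable _ _)
    rw [one_smul, zero_smul, intervalIntegral.integral_of_le zero_le_one] at h
    beta_reduce
    rw [← h, ← integral_smul]
    refine integral_congr_ae (Eventually.of_forall fun t => ?_)
    simp only [hlin (t • y) y, smul_add, smul_smul, Pi.add_apply]
    congr 2 <;> ring
  have g1 : Integrable fun y => gaussWeight (1/2) y • f y := by
    have := integrable_smul_comp_smul (K := 1) cg hf.continuous (fun y => by
      rw [abs_of_nonneg (gaussWeight_nonneg _ _), one_mul]
      exact gaussWeight_anti (by norm_num) y) h0 (t := 1) (by simp)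
    simpa using this
  have g2 : Integrable fun y => gaussWeight (1/2) y • f 0 :=
    (integrable_gaussWeight (by norm_num)).smul_const _
  simp only [smul_sub] at hray
  rw [integral_sub g1 g2, integral_smul_const, integral_gaussWeight (by norm_num)] at hray
  have e1 : Real.pi / (1/2) = 2 * Real.pi := by ring
  rw [e1] at hray
  rw [← neg_sub, hray]
  congr 1
  have hang' := congrArg (fun z => (-Complex.I) * z) hang
  simp only [← integral_const_mul, mul_zero] at hang'
  rw [← sub_eq_zero, ← neg_eq_zero, neg_sub]
  have ia : Integrable (fun ω : (ℝ × ℝ) × ℝ =>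
    (ω.1.1 * gaussWeight (1/2) ω.1) • fderiv ℝ f (ω.2 • ω.1) (1, 0) +
      (ω.1.2 * gaussWeight (1/2) ω.1) • fderiv ℝ f (ω.2 • ω.1) (0, 1)) rayMeasure := i11.add i22
  have ib : Integrable (fun ω : (ℝ × ℝ) × ℝ =>
    (ω.1.1 * gaussWeight (1/2) ω.1) • fderiv ℝ f (ω.2 • ω.1) (0, 1) -
      (ω.1.2 * gaussWeight (1/2) ω.1) • fderiv ℝ f (ω.2 • ω.1) (1, 0)) rayMeasure := i12.sub i21
  have ee : (fun ω : (ℝ × ℝ) × ℝ => (gaussWeight (1/2) ω.1 : ℂ) * (starRingEnd ℂ) (planeToC ω.1) *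
        (fderiv ℝ f (ω.2 • ω.1) (1, 0) + Complex.I * fderiv ℝ f (ω.2 • ω.1) (0, 1))) =
      fun ω => ((ω.1.1 * gaussWeight (1/2) ω.1) • fderiv ℝ f (ω.2 • ω.1) (1, 0) +
      (ω.1.2 * gaussWeight (1/2) ω.1) • fderiv ℝ f (ω.2 • ω.1) (0, 1)) - (-Complex.I *
      ((ω.1.1 * gaussWeight (1/2) ω.1) • fderiv ℝ f (ω.2 • ω.1) (0, 1) -
      (ω.1.2 * gaussWeight (1/2) ω.1) • fderiv ℝ f (ω.2 • ω.1) (1, 0))) := by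
    ext ω
    simp only [planeToC, map_add, map_mul, Complex.conj_ofReal, Complex.conj_I, Complex.real_smul]
    push_cast
    linear_combination (-(ω.1.2 : ℂ) * gaussWeight (1/2) ω.1 * fderiv ℝ f (ω.2 • ω.1) (0, 1)) *
      Complex.I_sq
  rw [ee, integral_sub ia (ib.const_mul _), hang', sub_zero, sub_self]

end meanValue

/-- The weight controlling the distance to the lowest Landau band. -/
noncomputable def gapWeight (ω : (ℝ × ℝ) × ℝ) : ℝ :=
  1 / (2 * Real.pi) * (‖planeToC ω.1‖ * gaussWeight (1/4) ω.1)

lemma gapWeight_nonneg (ω : (ℝ × ℝ) × ℝ) : 0 ≤ gapWeight ω := by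
  have := gaussWeight_nonneg (1/4) ω.1
  unfold gapWeight
  positivity

lemma integrable_gapWeight : Integrable gapWeight rayMeasure := by
  have h : Integrable fun y => 1 / (2 * Real.pi) * (‖planeToC y‖ * gaussWeight (1/4) y) := by
    refine Integrable.const_mul ?_ _
    refine Integrable.mono' ((integrable_gaussWeight (b := 3/16) (by norm_num)).const_mul 4)
      (continuous_planeToC.norm.mul (continuous_gaussWeight _)).aestronglyMeasurable
      (Eventually.of_forall fun y => ?_)
    rw [Real.norm_eq_abs, abs_of_nonneg (mul_nonneg (norm_nonneg _) (gaussWeight_nonneg _ _))]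
    exact norm_planeToC_mul_gaussWeight_le (by norm_num) y
  exact h.comp_fst _

lemma magTrans_zero (x : ℝ × ℝ) (u : ℝ × ℝ → ℂ) : magTrans x u 0 = u x := by
  simp [magTrans, magPhase]

lemma norm_sub_landauProj_le {u : ℝ × ℝ → ℂ} (hu : ContDiff ℝ (⊤ : ℕ∞) u) {C : ℝ}
    (h0 : ∀ x, ‖u x‖ ≤ C) (h1 : ∀ x, ‖D1 u x‖ ≤ C) (h2 : ∀ x, ‖D2 u x‖ ≤ C) (x : ℝ × ℝ) :
    ‖u x - landauProj u x‖ ≤ ∫ ω, gapWeight ω * ‖annih u (x + ω.2 • ω.1)‖ ∂rayMeasure := by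
  have hC0 : 0 ≤ C := (norm_nonneg _).trans (h0 0)
  set V := magTrans x u with hVdef
  have hV : ContDiff ℝ (⊤ : ℕ∞) V := contDiff_magTrans hu
  have dV : Differentiable ℝ V := hV.differentiable (by simp)
  have du : Differentiable ℝ u := hu.differentiable (by simp)
  have nV : ∀ z, ‖V z‖ ≤ C := fun z => by
    rw [hVdef, magTrans, norm_mul, norm_magPhase, one_mul]; exact h0 _
  have nV1 : ∀ z, ‖D1 V z‖ ≤ C := fun z => by
    rw [hVdef, D1_magTrans (du _), norm_mul, norm_magPhase, one_mul]; exact h1 _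
  have nV2 : ∀ z, ‖D2 V z‖ ≤ C := fun z => by
    rw [hVdef, D2_magTrans (du _), norm_mul, norm_magPhase, one_mul]; exact h2 _
  set f : ℝ × ℝ → ℂ := fun z => gaussWeight (-(1/4)) z • V z with hf
  have cf : ContDiff ℝ (⊤ : ℕ∞) f := (contDiff_gaussWeight _).smul hV
  have fd : ∀ z v, fderiv ℝ f z v = gaussWeight (-(1/4)) z • (fderiv ℝ V z v
      + ((1/2 * (z.1 * v.1 + z.2 * v.2) : ℝ) : ℂ) * V z) := by
    intro z v
    rw [hf, fderiv_fun_smul ((contDiff_gaussWeight _).differentiable (by simp) z) (dV z)]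
    simp only [add_apply, smul_apply, ContinuousLinearMap.smulRight_apply, fderiv_gaussWeight,
      Complex.real_smul]
    push_cast
    ring
  have fd1 : ∀ z, fderiv ℝ f z (1, 0) = gaussWeight (-(1/4)) z • (D1 V z
      + (z.1 - Complex.I * z.2) / 2 * V z) := by
    intro z
    rw [fd]
    simp only [D1, A0]
    congr 1
    push_cast
    ring
  have fd2 : ∀ z, fderiv ℝ f z (0, 1) = gaussWeight (-(1/4)) z • (D2 V z
      + (z.2 + Complex.I * z.1) / 2 * V z) := by
    intro z
    rw [fd]
    simp only [D2, A0]
    congr 1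
    push_cast
    ring
  have gb0 : ∀ z, gaussWeight (-(1/4)) z ≤ gaussWeight (-(5/16)) z :=
    gaussWeight_anti (by norm_num)
  have gb1 : ∀ z, ‖planeToC z‖ * gaussWeight (-(1/4)) z ≤ 4 * gaussWeight (-(5/16)) z :=
    norm_planeToC_mul_gaussWeight_le (by norm_num)
  have aux : ∀ (z : ℝ × ℝ) (a c : ℂ), ‖a‖ ≤ C → ‖c‖ ≤ ‖planeToC z‖ →
      ‖gaussWeight (-(1/4)) z • (a + c / 2 * V z)‖ ≤ (5 * C) * gaussWeight (-(5/16)) z := by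
    intro z a c ha hc
    rw [norm_smul, Real.norm_eq_abs, abs_of_nonneg (gaussWeight_nonneg _ _)]
    have e1 : ‖a + c / 2 * V z‖ ≤ C + ‖planeToC z‖ * C := by
      refine (norm_add_le _ _).trans (add_le_add ha ?_)
      rw [norm_mul, norm_div]
      refine mul_le_mul ?_ (nV z) (norm_nonneg _) (norm_nonneg _)
      simp only [Complex.norm_ofNat]
      linarith [norm_nonneg c]
    have e2 := mul_le_mul_of_nonneg_left e1 (gaussWeight_nonneg (-(1/4)) z)
    nlinarith [gb0 z, gb1 z]
  have nc1 : ∀ z : ℝ × ℝ, ‖(z.1 - Complex.I * z.2 : ℂ)‖ = ‖planeToC z‖ := fun z => by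
    rw [← Complex.norm_conj (planeToC z), planeToC]
    simp
    ring_nf
  have nc2 : ∀ z : ℝ × ℝ, ‖(z.2 + Complex.I * z.1 : ℂ)‖ = ‖planeToC z‖ := fun z => by
    rw [← nc1, show (z.2 + Complex.I * z.1 : ℂ) = Complex.I * (z.1 - Complex.I * z.2) by
      linear_combination (z.2:ℂ) * Complex.I_sq]
    simp
  have m0 : ∀ z, ‖f z‖ ≤ (5 * C) * gaussWeight (-(5/16)) z := fun z => by
    rw [hf]
    beta_reduce
    rw [norm_smul, Real.norm_eq_abs, abs_of_nonneg (gaussWeight_nonneg _ _)]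
    nlinarith [gb0 z, nV z, gaussWeight_nonneg (-(1/4)) z]
  have m1 : ∀ z, ‖fderiv ℝ f z (1, 0)‖ ≤ (5 * C) * gaussWeight (-(5/16)) z := fun z => by
    rw [fd1]
    exact aux z _ _ (nV1 z) (nc1 z).le
  have m2 : ∀ z, ‖fderiv ℝ f z (0, 1)‖ ≤ (5 * C) * gaussWeight (-(5/16)) z := fun z => by
    rw [fd2]
    exact aux z _ _ (nV2 z) (nc2 z).le
  have hdbar : ∀ z, fderiv ℝ f z (1, 0) + Complex.I * fderiv ℝ f z (0, 1) =
      gaussWeight (-(1/4)) z • annih V z := by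
    intro z
    rw [fd1, fd2, annih]
    simp only [Complex.real_smul]
    linear_combination (gaussWeight (-(1/4)) z * ((z.1 : ℂ) / 2) * V z) * Complex.I_sq
  have key := mean_value_identity cf m0 m1 m2
  simp only [hdbar] at key
  have ef0 : f 0 = u x := by
    rw [hf]
    beta_reduce
    rw [hVdef, magTrans_zero]
    simp [gaussWeight]
  have eint : ∫ y, gaussWeight (1/2) y • f y = (2 * Real.pi) • landauProj u x := by
    rw [landauProj, Complex.real_smul, ← mul_assoc, ← Complex.ofReal_mul,
      mul_one_div_cancel (by positivity), Complex.ofReal_one, one_mul]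
    refine integral_congr_ae (Eventually.of_forall fun y => ?_)
    beta_reduce
    rw [hf]
    beta_reduce
    rw [smul_smul, gaussWeight_mul, Complex.real_smul, hVdef]
    norm_num
  rw [ef0, eint, ← smul_sub] at key
  have hn := congrArg norm key
  rw [norm_smul, norm_neg, Real.norm_eq_abs, abs_of_pos (by positivity)] at hn
  have hbd : ∀ z, ‖‖annih u z‖‖ ≤ 2 * C := fun z => by
    rw [norm_norm, annih]
    refine (norm_add_le _ _).trans ?_
    rw [norm_mul, Complex.norm_I, one_mul]
    linarith [h1 z, h2 z]
  have hY : Measurable fun ω : (ℝ × ℝ) × ℝ => ω.2 • ω.1 :=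
    (continuous_snd.smul continuous_fst).measurable
  have hbound := integrable_weight_mul_comp_right integrable_gapWeight hY
    (continuous_annih hu).norm hbd x
  have e3 : 2 * Real.pi * ‖u x - landauProj u x‖ ≤
      ∫ ω, 2 * Real.pi * (gapWeight ω * ‖annih u (x + ω.2 • ω.1)‖) ∂rayMeasure := by
    rw [hn]
    refine (norm_integral_le_integral_norm _).trans ?_
    refine integral_mono_of_nonneg (Eventually.of_forall fun _ => norm_nonneg _)
      (hbound.const_mul _) ?_
    filter_upwards [ae_rayMeasure] with ω hω
    rw [hVdef, annih_magTrans (du _)]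
    simp only [norm_mul, norm_smul, norm_magPhase, Complex.norm_conj, Complex.norm_real,
      Real.norm_eq_abs, abs_of_nonneg (gaussWeight_nonneg _ _), one_mul]
    have e5 : 2 * Real.pi * gapWeight ω = ‖planeToC ω.1‖ * gaussWeight (1/4) ω.1 := by
      rw [gapWeight, ← mul_assoc, mul_one_div_cancel (by positivity), one_mul]
    rw [add_comm x, ← mul_assoc, ← mul_assoc, e5]
    refine mul_le_mul_of_nonneg_right ?_ (norm_nonneg _)
    have := gaussWeight_smul_le (b := 1/4) (by norm_num) ⟨hω.1.le, hω.2⟩ ω.1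
    have e4 : gaussWeight (1/2) ω.1 * gaussWeight (-(1/4)) ω.1 = gaussWeight (1/4) ω.1 := by
      rw [gaussWeight_mul]; norm_num
    calc gaussWeight (1/2) ω.1 * ‖planeToC ω.1‖ * gaussWeight (-(1/4)) (ω.2 • ω.1)
        ≤ gaussWeight (1/2) ω.1 * ‖planeToC ω.1‖ * gaussWeight (-(1/4)) ω.1 :=
          mul_le_mul_of_nonneg_left this (mul_nonneg (gaussWeight_nonneg _ _) (norm_nonneg _))
      _ = _ := by rw [← e4]; ring
  rw [integral_const_mul] at e3
  exact le_of_mul_le_mul_left e3 (by positivity)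

/-- The squared mass of `gapWeight`. -/
noncomputable def gapConst : ℝ := (∫ ω, gapWeight ω ∂rayMeasure) ^ 2

lemma setIntegral_norm_sub_landauProj_sq_le {R : ℝ} (hR : 0 < R) {u : ℝ × ℝ → ℂ}
    (hu : ContDiff ℝ (⊤ : ℕ∞) u) {C : ℝ}
    (h0 : ∀ x, ‖u x‖ ≤ C) (h1 : ∀ x, ‖D1 u x‖ ≤ C) (h2 : ∀ x, ‖D2 u x‖ ≤ C)
    (hp : DoublyPeriodic R fun x => ‖annih u x‖) :
    ∫ x in KR R, ‖u x - landauProj u x‖ ^ 2 ≤ gapConst * ∫ x in KR R, ‖annih u x‖ ^ 2 := by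
  have cp := (contDiff_landauProj hu.continuous h0).continuous
  have cu := hu.continuous
  refine setIntegral_sq_le_of_le_weighted hR gapWeight_nonneg integrable_gapWeight
    (Y := fun ω => ω.2 • ω.1) (continuous_snd.smul continuous_fst).measurable hp
    (continuous_annih hu).norm (w := fun x => ‖u x - landauProj u x‖) (by fun_prop) fun x => ?_
  rw [abs_norm]
  exact norm_sub_landauProj_le hu h0 h1 h2 x

/-- The weight of the projection onto the lowest Landau band. -/
noncomputable def landauWeight (y : ℝ × ℝ) : ℝ := 1 / (2 * Real.pi) * gaussWeight (1/4) y

lemma landauWeight_nonneg (y : ℝ × ℝ) : 0 ≤ landauWeight y :=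
  mul_nonneg (by positivity) (gaussWeight_nonneg _ _)

lemma integrable_landauWeight : Integrable landauWeight :=
  (integrable_gaussWeight (by norm_num)).const_mul _

lemma integral_landauWeight : ∫ y, landauWeight y = 2 := by
  unfold landauWeight
  rw [integral_const_mul, integral_gaussWeight (by norm_num)]
  have := Real.pi_ne_zero
  field_simp
  norm_num

lemma norm_landauProj_le (u : ℝ × ℝ → ℂ) (x : ℝ × ℝ) :
    ‖landauProj u x‖ ≤ ∫ y, landauWeight y * ‖u (x + y)‖ := by
  rw [landauProj, ← integral_const_mul]
  refine (norm_integral_le_integral_norm _).trans_eq ?_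
  refine integral_congr_ae (Eventually.of_forall fun y => ?_)
  simp only [norm_mul, magTrans, norm_magPhase, one_mul, Complex.norm_real, Real.norm_eq_abs,
    abs_of_nonneg (gaussWeight_nonneg _ _), landauWeight, add_comm x]
  rw [abs_of_nonneg (by positivity), mul_assoc]

section bounds

variable {u : ℝ × ℝ → ℂ} (hu : Continuous u) {C : ℝ} (hC : ∀ x, ‖u x‖ ≤ C)
include hu hC

lemma integrable_landauWeight_mul (n : ℕ) (x : ℝ × ℝ) :
    Integrable fun y => landauWeight y * ‖u (x + y)‖ ^ n :=
  integrable_weight_mul_comp_right (h := fun z => ‖u z‖ ^ n) integrable_landauWeight measurable_id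
    (hu.norm.pow n) (C := C ^ n) (fun z => by
      rw [norm_pow, norm_norm]; exact pow_le_pow_left₀ (norm_nonneg _) (hC z) n) x

lemma norm_landauProj_sq_le (x : ℝ × ℝ) :
    ‖landauProj u x‖ ^ 2 ≤ ∫ y, landauWeight y * (2 * ‖u (x + y)‖ ^ 2) := by
  refine (pow_le_pow_left₀ (norm_nonneg _) (norm_landauProj_le u x) 2).trans ?_
  have i1 := integrable_landauWeight_mul hu hC 1 x
  simp only [pow_one] at i1
  refine (sq_integral_weight_le landauWeight_nonneg integrable_landauWeight i1
    (integrable_landauWeight_mul hu hC 2 x)).trans_eq ?_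
  rw [integral_landauWeight, ← integral_const_mul]
  exact integral_congr_ae (Eventually.of_forall fun y => by ring)

lemma norm_landauProj_pow_four_le (x : ℝ × ℝ) :
    ‖landauProj u x‖ ^ 4 ≤ 8 * ∫ y, landauWeight y * ‖u (x + y)‖ ^ 4 := by
  have h := pow_le_pow_left₀ (by positivity) (norm_landauProj_sq_le hu hC x) 2
  have i2 : Integrable fun y => landauWeight y * (2 * ‖u (x + y)‖ ^ 2) := by
    refine ((integrable_landauWeight_mul hu hC 2 x).const_mul 2).congr
      (Eventually.of_forall fun y => ?_)
    simp only
    ring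
  have i4 : Integrable fun y => landauWeight y * (2 * ‖u (x + y)‖ ^ 2) ^ 2 := by
    refine ((integrable_landauWeight_mul hu hC 4 x).const_mul 4).congr
      (Eventually.of_forall fun y => ?_)
    simp only
    ring
  have h' := h.trans (sq_integral_weight_le landauWeight_nonneg integrable_landauWeight i2 i4)
  rw [← pow_mul] at h'
  refine h'.trans_eq ?_
  rw [integral_landauWeight, ← integral_const_mul, ← integral_const_mul]
  exact integral_congr_ae (Eventually.of_forall fun y => by ring)

lemma setIntegral_norm_landauProj_sq_le {R : ℝ} (hR : 0 < R)
    (hp : DoublyPeriodic R fun x => ‖u x‖) :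
    ∫ x in KR R, ‖landauProj u x‖ ^ 2 ≤ 4 * ∫ x in KR R, ‖u x‖ ^ 2 := by
  have cp := (contDiff_landauProj hu hC).continuous
  have h := setIntegral_sq_le_of_le_weighted hR landauWeight_nonneg integrable_landauWeight
    measurable_id hp hu.norm (w := fun x => ‖landauProj u x‖) cp.norm fun x => by
      rw [abs_norm]; exact norm_landauProj_le u x
  rw [integral_landauWeight] at h
  norm_num at h ⊢
  exact h

lemma setIntegral_norm_landauProj_pow_four_le {R : ℝ} (hR : 0 < R)
    (hp : DoublyPeriodic R fun x => ‖u x‖) :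
    ∫ x in KR R, ‖landauProj u x‖ ^ 4 ≤ 16 * ∫ x in KR R, ‖u x‖ ^ 4 := by
  have cp := (contDiff_landauProj hu hC).continuous
  have h := setIntegral_sq_le_of_le_weighted hR landauWeight_nonneg integrable_landauWeight
    measurable_id (h := fun x => 2 * ‖u x‖ ^ 2) (hp.comp fun a => 2 * a ^ 2)
    (by fun_prop) (w := fun x => ‖landauProj u x‖ ^ 2) (by fun_prop) fun x => by
      rw [abs_of_nonneg (by positivity)]; exact norm_landauProj_sq_le hu hC x
  rw [integral_landauWeight, ← integral_const_mul] at h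
  rw [← integral_const_mul]
  calc ∫ x in KR R, ‖landauProj u x‖ ^ 4 = ∫ x in KR R, (‖landauProj u x‖ ^ 2) ^ 2 := by
        simp only [← pow_mul]
    _ ≤ _ := h
    _ = _ := by congr 1; ext x; ring

lemma norm_landauProj_pow_four_le_setIntegral {R : ℝ} (hR : 1 ≤ R)
    (hp : DoublyPeriodic R fun x => ‖u x‖) (x : ℝ × ℝ) :
    ‖landauProj u x‖ ^ 4 ≤ 32 * Real.exp (1/8) * ∫ x in KR R, ‖u x‖ ^ 4 := by
  have hR0 : 0 < R := by linarith
  set k : ℝ × ℝ → ℝ := fun z => ‖u z‖ ^ 4 with hk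
  have ck : Continuous k := by fun_prop
  have pk : DoublyPeriodic R k := hp.comp (· ^ 4)
  have bk : ∀ z, ‖k z‖ ≤ C ^ 4 := fun z => by
    rw [hk]
    simp only [norm_pow, norm_norm]
    exact pow_le_pow_left₀ (norm_nonneg _) (hC z) 4
  set kx : ℝ × ℝ → ℝ := fun z => k (x + z) with hkx
  have ckx : Continuous kx := by fun_prop
  have pkx : DoublyPeriodic R kx := fun z => by
    have h := pk (x + z)
    simp only [Prod.fst_add, Prod.snd_add] at h
    refine ⟨?_, ?_⟩
    · rw [hkx]; beta_reduce; rw [← h.1]; congr 1; ext <;> simp; ring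
    · rw [hkx]; beta_reduce; rw [← h.2]; congr 1; ext <;> simp; ring
  have ig := integrable_gaussWeight (b := 1/8) (by norm_num)
  have key : ∀ t ∈ KR 1, ∫ y, landauWeight y * k (x + y) ≤
      1 / (2 * Real.pi) * Real.exp (1/8) * ∫ y, gaussWeight (1/8) y * kx (t + y) := by
    intro t ht
    rw [← integral_const_mul, ← integral_sub_right_eq_self (fun y => 1 / (2 * Real.pi) *
      Real.exp (1/8) * (gaussWeight (1/8) y * kx (t + y))) t]
    have i0 := (integrable_weight_mul_comp_right ig measurable_id ckx (fun z => bk (x + z)) t)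
    have i1 : Integrable fun y => 1 / (2 * Real.pi) *
      Real.exp (1/8) * (gaussWeight (1/8) y * kx (t + y)) := i0.const_mul _
    refine integral_mono (integrable_landauWeight_mul hu hC 4 x) (i1.comp_sub_right t)
      fun y => ?_
    have e : k (x + y) = kx (t + (y - t)) := by rw [hkx]; beta_reduce; congr 2; abel
    beta_reduce
    rw [e, landauWeight, mul_assoc, mul_assoc]
    refine mul_le_mul_of_nonneg_left ?_ (by positivity)
    rw [← mul_assoc]
    refine mul_le_mul_of_nonneg_right ?_ (by rw [hkx, hk]; positivity)
    rw [gaussWeight, gaussWeight, ← Real.exp_add]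
    refine Real.exp_le_exp.2 ?_
    obtain ⟨⟨a1, a2⟩, ⟨a3, a4⟩⟩ := ht
    simp only [Prod.fst_sub, Prod.snd_sub]
    nlinarith [sq_nonneg (y.1 + t.1), sq_nonneg (y.2 + t.2)]
  have hsub : KR 1 ⊆ KR R := by
    intro t ht
    obtain ⟨⟨a1, a2⟩, ⟨a3, a4⟩⟩ := ht
    exact ⟨⟨by linarith, by linarith⟩, ⟨by linarith, by linarith⟩⟩
  have iJ : IntegrableOn (fun t => ∫ y, gaussWeight (1/8) y * kx (t + y)) (KR R) :=
    (integrable_weight_mul_comp (R := R) ig measurable_id ckx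
      (fun z => bk (x + z))).integral_prod_left
  have nJ : ∀ t, 0 ≤ ∫ y, gaussWeight (1/8) y * kx (t + y) := fun t =>
    integral_nonneg fun y => mul_nonneg (gaussWeight_nonneg _ _) (by rw [hkx, hk]; positivity)
  have hfin : volume (KR 1) ≠ ⊤ := (isBounded_KR 1).measure_lt_top.ne
  have s1 : ∫ y, landauWeight y * k (x + y) ≤
      ∫ t in KR R, 1 / (2 * Real.pi) * Real.exp (1/8) * ∫ y, gaussWeight (1/8) y * kx (t + y) := by
    calc ∫ y, landauWeight y * k (x + y)
        = ∫ t in KR 1, ∫ y, landauWeight y * k (x + y) := by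
          rw [setIntegral_const, volume_real_KR zero_le_one]; simp
      _ ≤ ∫ t in KR 1, 1 / (2 * Real.pi) * Real.exp (1/8) *
          ∫ y, gaussWeight (1/8) y * kx (t + y) :=
          setIntegral_mono_on (integrableOn_const hfin)
            ((iJ.mono_set hsub).const_mul _) (measurableSet_KR 1) key
      _ ≤ _ := by
          refine setIntegral_mono_set (iJ.const_mul _) (Eventually.of_forall fun t => ?_)
            (Eventually.of_forall hsub)
          have := nJ t
          simp only [Pi.zero_apply]
          positivity
  have s2 := setIntegral_weighted hR0 ig measurable_id pkx ckx
  simp only [id] at s2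
  rw [integral_const_mul, s2, integral_gaussWeight (by norm_num),
    show ∫ z in KR R, kx z = ∫ z in KR R, k z by
      rw [← pk.setIntegral_comp_add hR0 ck x]
      simp only [hkx, add_comm x]] at s1
  have s3 := norm_landauProj_pow_four_le hu hC x
  refine s3.trans ((mul_le_mul_of_nonneg_left s1 (by norm_num)).trans_eq ?_)
  have := Real.pi_ne_zero
  field_simp
  ring

end bounds

lemma quartic_comparison {a q W P s : ℝ} (ha : 0 ≤ a) (hq : 0 ≤ q) (hqP : q ≤ P) (hs : 0 < s)
    (h1 : a - q ≤ W) (h2 : q - a ≤ W) :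
    -q ^ 2 + (1/2) * q ^ 4 ≤ -a ^ 2 + (1/2) * a ^ 4 + s * (a ^ 2 + q ^ 2)
      + (1/2 + P) / s * W ^ 2 + P * s * q ^ 4 := by
  have hW : 0 ≤ W := by linarith
  obtain ⟨m, hm, hms⟩ : ∃ m, W = m * s ∧ 0 ≤ m :=
    ⟨W / s, by field_simp, by positivity⟩
  have e : (1/2 + P) / s * W ^ 2 = (1/2 + P) * (m * W) := by
    rw [hm]; field_simp
  have hmW : m * W = s * m ^ 2 := by rw [hm]; ring
  rw [e]
  have i1 : a ^ 2 - q ^ 2 ≤ W * (a + q) := by nlinarith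
  have i2 : W * (a + q) ≤ s * (a ^ 2 + q ^ 2) + 1/2 * (m * W) := by
    rw [hmW, hm]
    nlinarith [mul_nonneg hs.le (sq_nonneg (a - q)), mul_nonneg hs.le (sq_nonneg (a + q - m))]
  have i3 : q ^ 4 - a ^ 4 ≤ 4 * q ^ 3 * W := by
    rcases le_total q a with h | h
    · have := pow_le_pow_left₀ hq h 4
      have : 0 ≤ 4 * q ^ 3 * W := by positivity
      linarith
    · have j1 : (q + a) * (q ^ 2 + a ^ 2) ≤ 4 * q ^ 3 := by
        have : (q + a) * (q ^ 2 + a ^ 2) ≤ (q + q) * (q ^ 2 + q ^ 2) := by gcongr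
        nlinarith
      calc q ^ 4 - a ^ 4 = (q - a) * ((q + a) * (q ^ 2 + a ^ 2)) := by ring
        _ ≤ W * (4 * q ^ 3) := mul_le_mul h2 j1 (by positivity) hW
        _ = _ := by ring
  have i4 : 2 * q ^ 3 * W ≤ P * s * q ^ 4 + P * (m * W) := by
    have j : 2 * q ^ 2 * W ≤ s * q ^ 4 + m * W := by
      rw [hmW, hm]
      nlinarith [mul_nonneg hs.le (sq_nonneg (q ^ 2 - m))]
    have hP : 0 ≤ P := hq.trans hqP
    calc 2 * q ^ 3 * W = q * (2 * q ^ 2 * W) := by ring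
      _ ≤ P * (s * q ^ 4 + m * W) := mul_le_mul hqP j (by positivity) hP
      _ = _ := by ring
  linarith

lemma exists_bound_periodize {R : ℝ} (hR : 0 < R) {v : ℝ × ℝ → ℂ} (hv : IsTestFn R v) :
    ∃ C, (∀ x, ‖periodize R v x‖ ≤ C) ∧ (∀ x, ‖D1 (periodize R v) x‖ ≤ C) ∧
      ∀ x, ‖D2 (periodize R v) x‖ ≤ C := by
  have hV := contDiff_periodize hR hv
  have hp := doublyPeriodic_foldPt hR
  have key : ∀ (f : ℝ × ℝ → ℂ) (g : ℝ × ℝ → ℂ), Continuous f →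
      (∀ x, f x = latticePhase R x * g (foldPt R x)) → ∃ C, ∀ x, ‖f x‖ ≤ C := by
    intro f g hf hfg
    have e : (fun x => ‖f x‖) = fun x => ‖g (foldPt R x)‖ := by
      ext x; rw [hfg, norm_mul, norm_latticePhase, one_mul]
    obtain ⟨C, hC⟩ := DoublyPeriodic.exists_norm_le (h := fun x => ‖f x‖) hR
      (by rw [e]; exact hp.comp fun x => ‖g x‖) hf.norm
    exact ⟨C, fun x => by simpa using hC x⟩
  obtain ⟨C0, h0⟩ := key (periodize R v) v hV.continuous fun x => rfl
  obtain ⟨C1, h1⟩ := key _ _ (continuous_D1 hV) (D1_periodize hR hv)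
  obtain ⟨C2, h2⟩ := key _ _ (continuous_D2 hV) (D2_periodize hR hv)
  exact ⟨max C0 (max C1 C2), fun x => (h0 x).trans (le_max_left _ _),
    fun x => (h1 x).trans ((le_max_left _ _).trans (le_max_right _ _)),
    fun x => (h2 x).trans ((le_max_right _ _).trans (le_max_right _ _))⟩

lemma cAb_le_scaledEnergy {R : ℝ} (hR : 1 ≤ R) {N : ℕ} (hN : R ^ 2 = 2 * Real.pi * N)
    {v : ℝ × ℝ → ℂ} (hv : IsTestFn R v) {s P : ℝ} (hs : 0 < s) (hP : 0 ≤ P)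
    (hPv : 32 * Real.exp (1/8) * ∫ x in KR R, ‖v x‖ ^ 4 ≤ P ^ 4) :
    cAb R ≤ scaledEnergy ((1/2 + P) / s * gapConst) R v
      + 5 * s * (∫ x in KR R, ‖v x‖ ^ 2) + 16 * (P * s) * ∫ x in KR R, ‖v x‖ ^ 4 := by
  have hR0 : 0 < R := by linarith
  set κ := (1/2 + P) / s * gapConst with hκ
  have e2 := setIntegral_KR_periodize hR0 hv fun a _ => ‖a‖ ^ 2
  have e4 := setIntegral_KR_periodize hR0 hv fun a _ => ‖a‖ ^ 4
  have hV := contDiff_periodize hR0 hv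
  have hpV := (magPeriodic_periodize hR0 hN v).norm
  have gV := gaugePeriodic_periodize hR0 hv
  obtain ⟨C, h0, h1, h2⟩ := exists_bound_periodize hR0 hv
  rw [← scaledEnergy_periodize hR0 hv, ← e2, ← e4]
  rw [← e4] at hPv
  have hmp := magPeriodic_landauProj (magPeriodic_periodize hR0 hN v)
  set V := periodize R v with hVdef
  have cV := hV.continuous
  have cp := (contDiff_landauProj cV h0).continuous
  have ca := continuous_annih hV
  have gap := setIntegral_norm_sub_landauProj_sq_le hR0 hV h0 h1 h2 gV.norm_annih
  have b2 := setIntegral_norm_landauProj_sq_le cV h0 hR0 hpV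
  have b4 := setIntegral_norm_landauProj_pow_four_le cV h0 hR0 hpV
  have hsup : ∀ x, ‖landauProj V x‖ ≤ P := fun x =>
    le_of_pow_le_pow_left₀ (by norm_num : 4 ≠ 0) hP
      ((norm_landauProj_pow_four_le_setIntegral cV h0 hR hpV x).trans hPv)
  refine (cAb_le hR0 (contDiff_landauProj cV h0) hmp (lll_landauProj cV h0)).trans ?_
  set c := (1/2 + P) / s with hc
  have hc0 : 0 ≤ c := by positivity
  have iE : IntegrableOn (fun x => energyDensity κ V x) (KR R) :=
    integrableOn_KR (continuous_energyDensity κ hV) R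
  have i1 : IntegrableOn (fun x => s * ‖V x‖ ^ 2) (KR R) := integrableOn_KR (by fun_prop) R
  have i2 : IntegrableOn (fun x => s * ‖landauProj V x‖ ^ 2) (KR R) :=
    integrableOn_KR (by fun_prop) R
  have i3 : IntegrableOn (fun x => c * ‖V x - landauProj V x‖ ^ 2) (KR R) :=
    integrableOn_KR (by fun_prop) R
  have i4 : IntegrableOn (fun x => P * s * ‖landauProj V x‖ ^ 4) (KR R) :=
    integrableOn_KR (by fun_prop) R
  have i5 : IntegrableOn (fun x => κ * ‖annih V x‖ ^ 2) (KR R) :=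
    integrableOn_KR (by fun_prop) R
  have i6 : IntegrableOn (fun x => -‖landauProj V x‖ ^ 2 + (1/2) * ‖landauProj V x‖ ^ 4)
      (KR R) := integrableOn_KR (by fun_prop) R
  have j0 : IntegrableOn (fun x => energyDensity κ V x - κ * ‖annih V x‖ ^ 2) (KR R) :=
    iE.sub i5
  have j1 : IntegrableOn (fun x => energyDensity κ V x - κ * ‖annih V x‖ ^ 2
      + s * ‖V x‖ ^ 2) (KR R) := j0.add i1
  have j2 : IntegrableOn (fun x => energyDensity κ V x - κ * ‖annih V x‖ ^ 2
      + s * ‖V x‖ ^ 2 + s * ‖landauProj V x‖ ^ 2) (KR R) := j1.add i2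
  have j3 : IntegrableOn (fun x => energyDensity κ V x - κ * ‖annih V x‖ ^ 2
      + s * ‖V x‖ ^ 2 + s * ‖landauProj V x‖ ^ 2 + c * ‖V x - landauProj V x‖ ^ 2)
      (KR R) := j2.add i3
  have main : FAb R (landauProj V) ≤ ∫ x in KR R, (energyDensity κ V x - κ * ‖annih V x‖ ^ 2
      + s * ‖V x‖ ^ 2 + s * ‖landauProj V x‖ ^ 2 + c * ‖V x - landauProj V x‖ ^ 2
      + P * s * ‖landauProj V x‖ ^ 4) := by
    refine integral_mono i6 (j3.add i4) fun x => ?_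
    have h := quartic_comparison (norm_nonneg (V x)) (norm_nonneg (landauProj V x)) (hsup x) hs
      (norm_sub_norm_le _ _) ((norm_sub_norm_le _ _).trans_eq (norm_sub_rev _ _))
    simp only [energyDensity]
    linarith
  rw [integral_add j3 i4, integral_add j2 i3, integral_add j1 i2, integral_add j0 i1,
    integral_sub iE i5] at main
  simp only [integral_const_mul] at main
  have m3 := mul_le_mul_of_nonneg_left gap hc0
  have m2 := mul_le_mul_of_nonneg_left b2 hs.le
  have m4 := mul_le_mul_of_nonneg_left b4 (mul_nonneg hP hs.le)
  rw [scaledEnergy]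
  rw [hκ] at main ⊢
  linarith

lemma integral_norm_pow_four_le {κ : ℝ} (hκ : 0 ≤ κ) (R : ℝ) {v : ℝ × ℝ → ℂ}
    (hv : ContDiff ℝ (⊤ : ℕ∞) v) :
    ∫ x in KR R, ‖v x‖ ^ 4 ≤ 2 * (scaledEnergy κ R v + ∫ x in KR R, ‖v x‖ ^ 2) := by
  have hc := hv.continuous
  have i2 : IntegrableOn (fun x => ‖v x‖ ^ 2) (KR R) := integrableOn_KR (by fun_prop) R
  have i4 : IntegrableOn (fun x => ‖v x‖ ^ 4) (KR R) := integrableOn_KR (by fun_prop) R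
  have iE : IntegrableOn (fun x => energyDensity κ v x) (KR R) :=
    integrableOn_KR (continuous_energyDensity κ hv) R
  rw [scaledEnergy, ← integral_add iE i2, ← integral_const_mul]
  refine integral_mono i4 ((iE.add i2).const_mul 2) fun x => ?_
  have : 0 ≤ κ * ‖annih v x‖ ^ 2 := by positivity
  simp only [energyDensity]
  linarith

lemma gapConst_nonneg : 0 ≤ gapConst := sq_nonneg _

/-- The coupling at which the Landau band projection is compared on the square of side `T ^ 4`. -/
noncomputable def projCoupling (T : ℝ) : ℝ := (1/2 + 5 * T ^ 2) / (1 / T ^ 3) * gapConst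

lemma projCoupling_nonneg {T : ℝ} (hT : 1 ≤ T) : 0 ≤ projCoupling T := by
  have := gapConst_nonneg
  have : 0 < T := by linarith
  rw [projCoupling]
  positivity

lemma projCoupling_le {T : ℝ} (hT : 1 ≤ T) : projCoupling T ≤ 6 * T ^ 5 * gapConst := by
  refine mul_le_mul_of_nonneg_right ?_ gapConst_nonneg
  have h2 : (1:ℝ) ≤ T ^ 2 := one_le_pow₀ hT
  have h3 : (0:ℝ) < T ^ 3 := by positivity
  rw [div_div_eq_mul_div, div_one]
  calc (1/2 + 5 * T ^ 2) * T ^ 3 ≤ (6 * T ^ 2) * T ^ 3 := by gcongr; linarith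
    _ = _ := by ring

lemma exp_eighth_le : Real.exp (1/8) ≤ 2 := by
  have h := Real.exp_bound_div_one_sub_of_interval (x := 1/8) (by norm_num) (by norm_num)
  norm_num at h ⊢
  linarith

lemma cAb_le_scaledInf {T : ℝ} (hT : 1 ≤ T) {N : ℕ} (hN : (T ^ 4) ^ 2 = 2 * Real.pi * N) :
    cAb (T ^ 4) ≤ scaledInf (projCoupling T) (T ^ 4) + 656 * T ^ 7 := by
  have hT0 : 0 < T := by linarith
  have hR : 1 ≤ T ^ 4 := one_le_pow₀ hT
  have hR2 : 1 ≤ T ^ 8 := one_le_pow₀ hT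
  have hκ := projCoupling_nonneg hT
  obtain ⟨_, ⟨v, hv, rfl⟩, hlt⟩ := exists_lt_of_csInf_lt
    (⟨_, _, isTestFn_zero (T ^ 4), rfl⟩ :
      {E : ℝ | ∃ u : ℝ × ℝ → ℂ, IsTestFn (T ^ 4) u ∧
        E = scaledEnergy (projCoupling T) (T ^ 4) u}.Nonempty)
    (show sInf _ < scaledInf (projCoupling T) (T ^ 4) + 1 from lt_add_of_pos_right _ one_pos)
  have h0 := scaledInf_nonpos hκ (R := T ^ 4) (by positivity)
  have a2 := integral_norm_sq_le hκ (L := T ^ 4) (by positivity) hv.1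
  have a4 := integral_norm_pow_four_le hκ (T ^ 4) hv.1
  rw [← pow_mul] at a2
  norm_num at a2
  have b2 : ∫ x in KR (T ^ 4), ‖v x‖ ^ 2 ≤ 3 * T ^ 8 := by linarith
  have b4 : ∫ x in KR (T ^ 4), ‖v x‖ ^ 4 ≤ 8 * T ^ 8 := by linarith
  have hPv : 32 * Real.exp (1/8) * ∫ x in KR (T ^ 4), ‖v x‖ ^ 4 ≤ (5 * T ^ 2) ^ 4 := by
    calc 32 * Real.exp (1/8) * ∫ x in KR (T ^ 4), ‖v x‖ ^ 4
        ≤ 32 * 2 * (8 * T ^ 8) := by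
          have : 0 ≤ ∫ x in KR (T ^ 4), ‖v x‖ ^ 4 := integral_nonneg fun x => by positivity
          gcongr
          exact exp_eighth_le
      _ ≤ _ := by ring_nf; linarith
  have key := cAb_le_scaledEnergy hR hN hv (s := 1 / T ^ 3) (P := 5 * T ^ 2) (by positivity)
    (by positivity) hPv
  rw [← projCoupling] at key
  have c2 : 5 * (1 / T ^ 3) * ∫ x in KR (T ^ 4), ‖v x‖ ^ 2 ≤ 15 * T ^ 5 := by
    calc _ ≤ 5 * (1 / T ^ 3) * (3 * T ^ 8) := by gcongr
      _ = _ := by field_simp; ring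
  have c4 : 16 * (5 * T ^ 2 * (1 / T ^ 3)) * ∫ x in KR (T ^ 4), ‖v x‖ ^ 4 ≤ 640 * T ^ 7 := by
    calc _ ≤ 16 * (5 * T ^ 2 * (1 / T ^ 3)) * (8 * T ^ 8) := by gcongr
      _ = _ := by field_simp; ring
  have d1 : (1:ℝ) ≤ T ^ 7 := one_le_pow₀ hT
  have d2 : T ^ 5 ≤ T ^ 7 := pow_le_pow_right₀ hT (by norm_num)
  linarith

lemma exists_cAb_le {θ : ℝ} (hθ : 0 < θ) (hθ1 : θ < 1) : ∃ C : ℝ, ∀ (T : ℝ) (N : ℕ), 1 ≤ T →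
    (T ^ 4) ^ 2 = 2 * Real.pi * N → cAb (T ^ 4) / (T ^ 4) ^ 2 ≤ (1 - θ) * limitEnergy + C / T := by
  obtain ⟨χ, hχ, hs, ht, h01, hA, -⟩ := exists_cutoff hθ hθ1
  set B := ∫ x, (fderiv ℝ χ x (1, 0) ^ 2 + fderiv ℝ χ x (0, 1) ^ 2) with hB
  have hB0 : 0 ≤ B := integral_nonneg fun x => by positivity
  refine ⟨18 * gapConst * B + 656, fun T N hT hN => ?_⟩
  have hT0 : 0 < T := by linarith
  have hκ := projCoupling_nonneg hT
  have h1 := cAb_le_scaledInf hT hN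
  have h2 := scaledInf_le_bulkEnergy hκ (S := T ^ 4) (by positivity) hχ hs ht h01
  have h3 : (∫ x, χ x ^ 2) * bulkEnergy (projCoupling T) ≤ (1 - θ) * limitEnergy := by
    have e1 := mul_le_mul_of_nonpos_right hA (bulkEnergy_nonpos hκ)
    have e2 := mul_le_mul_of_nonneg_left (bulkEnergy_le_limitEnergy hκ) (sub_nonneg.2 hθ1.le)
    linarith
  have h4 := mul_le_mul_of_nonneg_left h3 (by positivity : 0 ≤ (T ^ 4) ^ 2)
  have h5 := mul_le_mul_of_nonneg_right (projCoupling_le hT) hB0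
  have h6 : T ^ 5 * (gapConst * B) ≤ T ^ 7 * (gapConst * B) :=
    mul_le_mul_of_nonneg_right (pow_le_pow_right₀ hT (by norm_num))
      (mul_nonneg gapConst_nonneg hB0)
  rw [div_le_iff₀ (by positivity)]
  have e : ((1 - θ) * limitEnergy + (18 * gapConst * B + 656) / T) * (T ^ 4) ^ 2
      = (T ^ 4) ^ 2 * ((1 - θ) * limitEnergy) + (18 * gapConst * B + 656) * T ^ 7 := by
    field_simp
  rw [e]
  linarith

lemma tendsto_cAb_div_sq :
    Tendsto (fun N : ℕ => cAb (Real.sqrt (2 * Real.pi * N)) / (2 * Real.pi * N))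
      atTop (nhds limitEnergy) := by
  have hlim : Tendsto (fun N : ℕ => Real.sqrt (Real.sqrt (Real.sqrt (2 * Real.pi * N))))
      atTop atTop := by
    have h : Tendsto (fun N : ℕ => 2 * Real.pi * (N : ℝ)) atTop atTop :=
      tendsto_natCast_atTop_atTop.const_mul_atTop (by positivity)
    exact Real.tendsto_sqrt_atTop.comp (Real.tendsto_sqrt_atTop.comp
      (Real.tendsto_sqrt_atTop.comp h))
  have hsq : ∀ N : ℕ, Real.sqrt (2 * Real.pi * N) ^ 2 = 2 * Real.pi * N := fun N =>
    Real.sq_sqrt (by positivity)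
  rw [tendsto_order]
  constructor
  · intro t ht
    filter_upwards [eventually_gt_atTop 0] with N hN
    have hN' : (0:ℝ) < N := by exact_mod_cast hN
    have hpos : 0 < 2 * Real.pi * N := by positivity
    have h := limitEnergy_mul_sq_le_cAb (Real.sqrt_pos.2 hpos)
    rw [hsq, ← le_div_iff₀ hpos] at h
    exact ht.trans_le h
  · intro t ht
    obtain ⟨θ, hθ, hθ1, hθt⟩ : ∃ θ : ℝ, 0 < θ ∧ θ < 1 ∧ (1 - θ) * limitEnergy < t := by
      have hc : Tendsto (fun θ : ℝ => (1 - θ) * limitEnergy) (nhdsWithin 0 (Ioi 0))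
          (nhds ((1 - 0) * limitEnergy)) :=
        ((continuous_const.sub continuous_id).mul continuous_const).continuousWithinAt
      rw [sub_zero, one_mul] at hc
      have h1 : ∀ᶠ θ : ℝ in nhdsWithin 0 (Ioi 0), θ ∈ Ioo (0:ℝ) 1 :=
        Ioo_mem_nhdsGT one_pos
      obtain ⟨θ, h2, h3⟩ := ((hc.eventually_lt_const ht).and h1).exists
      exact ⟨θ, h3.1, h3.2, h2⟩
    obtain ⟨C, hC⟩ := exists_cAb_le hθ hθ1
    have hconv : Tendsto (fun T : ℝ => (1 - θ) * limitEnergy + C / T) atTop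
        (nhds ((1 - θ) * limitEnergy + 0)) :=
      tendsto_const_nhds.add (tendsto_const_nhds.div_atTop tendsto_id)
    rw [add_zero] at hconv
    filter_upwards [(hconv.comp hlim).eventually_lt_const hθt,
      hlim.eventually_ge_atTop 1] with N h1 h2
    have e : Real.sqrt (Real.sqrt (Real.sqrt (2 * Real.pi * N))) ^ 4
        = Real.sqrt (2 * Real.pi * N) := by
      rw [show (4:ℕ) = 2 * 2 from rfl, pow_mul, Real.sq_sqrt (Real.sqrt_nonneg _),
        Real.sq_sqrt (Real.sqrt_nonneg _)]
    have h := hC _ N h2 (by rw [e, hsq])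
    rw [e, hsq] at h
    exact h.trans_lt h1

lemma LLL.const_mul {u : ℝ × ℝ → ℂ} (hu : Differentiable ℝ u) (hl : LLL u) (c : ℂ) :
    LLL fun x => c * u x := by
  intro x
  rw [fderiv_const_mul (hu x)]
  simp only [smul_apply, smul_eq_mul]
  linear_combination c * hl x

lemma MagPeriodic.const_mul {R : ℝ} {u : ℝ × ℝ → ℂ} (hp : MagPeriodic R u) (c : ℂ) :
    MagPeriodic R fun x => c * u x := by
  intro x
  simp only [(hp x).1, (hp x).2]
  constructor <;> ring

lemma cAb_neg {R : ℝ} (hR : 0 < R) {u : ℝ × ℝ → ℂ} (hu : ContDiff ℝ (⊤ : ℕ∞) u)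
    (hp : MagPeriodic R u) (hl : LLL u) (h0 : u 0 ≠ 0) : cAb R < 0 := by
  have cu := hu.continuous
  have i2 : IntegrableOn (fun x => ‖u x‖ ^ 2) (KR R) := integrableOn_KR (by fun_prop) R
  have i4 : IntegrableOn (fun x => ‖u x‖ ^ 4) (KR R) := integrableOn_KR (by fun_prop) R
  set A2 := ∫ x in KR R, ‖u x‖ ^ 2 with hA2
  set A4 := ∫ x in KR R, ‖u x‖ ^ 4 with hA4
  have p4 : 0 ≤ A4 := integral_nonneg fun x => by positivity
  have p2 : 0 < A2 := by
    rw [hA2, setIntegral_pos_iff_support_of_nonneg_ae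
      (Eventually.of_forall fun x => by positivity) i2]
    have ho : IsOpen (Function.support fun x => ‖u x‖ ^ 2) :=
      (by fun_prop : Continuous fun x => ‖u x‖ ^ 2).isOpen_support
    refine (ho.inter (isOpen_KR R)).measure_pos volume ⟨0, ?_, ?_⟩
    · simpa using h0
    · refine ⟨⟨?_, ?_⟩, ⟨?_, ?_⟩⟩ <;> simp only [Prod.fst_zero, Prod.snd_zero] <;> linarith
  set τ := A2 / (A4 + 1) with hτ
  have hτ0 : 0 < τ := by positivity
  have hτ4 : τ * A4 ≤ A2 := by
    have : τ * (A4 + 1) = A2 := by rw [hτ]; field_simp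
    linarith
  set c : ℂ := ((Real.sqrt τ : ℝ) : ℂ) with hc
  have hcn : ‖c‖ ^ 2 = τ := by
    rw [hc, Complex.norm_real, Real.norm_of_nonneg (Real.sqrt_nonneg _), Real.sq_sqrt hτ0.le]
  refine (cAb_le hR (contDiff_const.mul hu) (hp.const_mul c)
    (hl.const_mul (hu.differentiable (by simp)) c)).trans_lt ?_
  have e : FAb R (fun x => c * u x) = -τ * A2 + 1 / 2 * τ ^ 2 * A4 := by
    have j2 : IntegrableOn (fun x => -τ * ‖u x‖ ^ 2) (KR R) := i2.const_mul _
    have j4 : IntegrableOn (fun x => 1 / 2 * τ ^ 2 * ‖u x‖ ^ 4) (KR R) := i4.const_mul _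
    rw [hA2, hA4, ← integral_const_mul, ← integral_const_mul, ← integral_add j2 j4, FAb]
    refine integral_congr_ae (Eventually.of_forall fun x => ?_)
    simp only [norm_mul, mul_pow, ← hcn]
    ring
  rw [e]
  nlinarith [mul_pos hτ0 p2, mul_le_mul_of_nonneg_left hτ4 hτ0.le]

lemma eventually_mem_KR {r : ℕ → ℝ} (hr : Tendsto r atTop atTop) (y : ℝ × ℝ) :
    ∀ᶠ N in atTop, y ∈ KR (r N) := by
  filter_upwards [hr.eventually_gt_atTop (2 * |y.1|), hr.eventually_gt_atTop (2 * |y.2|)]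
    with N h1 h2
  have a1 := abs_le.1 (le_refl |y.1|)
  have a2 := abs_le.1 (le_refl |y.2|)
  exact ⟨⟨by linarith, by linarith⟩, ⟨by linarith, by linarith⟩⟩

lemma exists_landauProj_ne_zero : ∃ (N : ℕ) (R : ℝ) (v : ℝ × ℝ → ℂ), 0 < R ∧
    R ^ 2 = 2 * Real.pi * N ∧ IsTestFn R v ∧ landauProj (periodize R v) 0 ≠ 0 := by
  obtain ⟨χ, hχ, hs, ht, h01, hA, -⟩ := exists_cutoff (θ := 1/2) (by norm_num) (by norm_num)
  set v : ℝ × ℝ → ℂ := fun x => (χ x : ℂ) with hv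
  set r : ℕ → ℝ := fun N => Real.sqrt (2 * Real.pi * N) with hr
  have hrt : Tendsto r atTop atTop :=
    Real.tendsto_sqrt_atTop.comp (tendsto_natCast_atTop_atTop.const_mul_atTop (by positivity))
  have cχ := hχ.continuous
  have hts : tsupport v = tsupport χ := by
    rw [tsupport, tsupport]
    congr 1
    ext x
    simp [hv]
  have hv1 : IsTestFn 1 v :=
    ⟨Complex.ofRealCLM.contDiff.comp hχ, by rw [HasCompactSupport, hts]; exact hs, by
      rw [hts]; exact ht⟩
  have hvR : ∀ R : ℝ, 1 ≤ R → IsTestFn R v := fun R hR =>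
    ⟨hv1.1, hv1.2.1, hv1.2.2.trans fun x hx =>
      ⟨⟨by linarith [hx.1.1], by linarith [hx.1.2]⟩, ⟨by linarith [hx.2.1], by linarith [hx.2.2]⟩⟩⟩
  have ig := integrable_gaussWeight (b := 1/4) (by norm_num)
  have hlim : Tendsto (fun N => ∫ y, (gaussWeight (1/4) y : ℂ) * magTrans 0 (periodize (r N) v) y)
      atTop (nhds (∫ y, (gaussWeight (1/4) y : ℂ) * v y)) := by
    refine tendsto_integral_filter_of_dominated_convergence (gaussWeight (1/4)) ?_ ?_ ig ?_
    · filter_upwards [hrt.eventually_ge_atTop 1] with N hN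
      have hc := (contDiff_periodize (by linarith) (hvR _ hN)).continuous
      have hg := continuous_gaussWeight (1/4)
      have hm : (fun y => (gaussWeight (1/4) y : ℂ) * magTrans 0 (periodize (r N) v) y)
          = fun y => (gaussWeight (1/4) y : ℂ) * periodize (r N) v y := by
        ext y; simp [magTrans, magPhase]
      rw [hm]
      exact (by fun_prop : Continuous _).aestronglyMeasurable
    · refine Eventually.of_forall fun N => Eventually.of_forall fun y => ?_
      rw [norm_mul, Complex.norm_real, Real.norm_of_nonneg (gaussWeight_nonneg _ _)]
      refine mul_le_of_le_one_right (gaussWeight_nonneg _ _) ?_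
      rw [magTrans, norm_mul, norm_magPhase, one_mul, periodize, norm_mul, norm_latticePhase,
        one_mul, hv, Complex.norm_real, Real.norm_of_nonneg (h01 _).1]
      exact (h01 _).2
    · refine Eventually.of_forall fun y => tendsto_nhds_of_eventually_eq ?_
      filter_upwards [eventually_mem_KR hrt y, hrt.eventually_ge_atTop 1] with N h1 h2
      obtain ⟨e1, e2⟩ := foldPt_eq_self (R := r N) (by linarith) h1
      simp [magTrans, magPhase, periodize, e1, e2]
  have hne : ∫ y, (gaussWeight (1/4) y : ℂ) * v y ≠ 0 := by
    have e : ∫ y, (gaussWeight (1/4) y : ℂ) * v y = ((∫ y, gaussWeight (1/4) y * χ y : ℝ) : ℂ) := by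
      rw [← integral_complex_ofReal]
      simp [hv]
    rw [e, Complex.ofReal_ne_zero]
    intro h
    have hi : Integrable fun y => gaussWeight (1/4) y * χ y :=
      ig.mul_bdd (c := 1) cχ.aestronglyMeasurable
        (Eventually.of_forall fun y => by
          rw [Real.norm_of_nonneg (h01 y).1]; exact (h01 y).2)
    rw [integral_eq_zero_iff_of_nonneg
      (fun y => mul_nonneg (gaussWeight_nonneg _ _) (h01 y).1) hi] at h
    have hz : ∫ y, χ y ^ 2 = 0 := by
      refine integral_eq_zero_of_ae (h.mono fun y hy => ?_)
      have hg : gaussWeight (1/4) y ≠ 0 := (Real.exp_pos _).ne'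
      have : χ y = 0 := (mul_eq_zero.1 hy).resolve_left hg
      simp [this]
    linarith
  obtain ⟨N, h1, h2⟩ := ((hlim.eventually_ne hne).and (hrt.eventually_ge_atTop 1)).exists
  refine ⟨N, r N, v, by linarith, Real.sq_sqrt (by positivity), hvR _ h2, ?_⟩
  rw [landauProj]
  refine mul_ne_zero ?_ h1
  rw [Complex.ofReal_ne_zero]
  positivity

lemma limitEnergy_neg : limitEnergy < 0 := by
  obtain ⟨N, R, v, hR, hN, hv, h0⟩ := exists_landauProj_ne_zero
  obtain ⟨C, hC, -, -⟩ := exists_bound_periodize hR hv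
  have cV := (contDiff_periodize hR hv).continuous
  have h := cAb_neg hR (contDiff_landauProj cV hC)
    (magPeriodic_landauProj (magPeriodic_periodize hR hN v)) (lll_landauProj cV hC) h0
  have h2 := limitEnergy_mul_sq_le_cAb hR
  by_contra hc
  have : 0 ≤ limitEnergy * R ^ 2 := mul_nonneg (not_lt.1 hc) (sq_nonneg R)
  linarith

/-- Existence and equality of the limits `lim_{b→1⁻} g(b)/(1-b)²` and
`lim_{R→∞, R²∈2πℕ} c(R)/R²`, both equal to a universal constant `E₂ ∈ [-1/2, 0)`. -/
theorem stmt_15 :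
    ∃ E₂ ∈ Ico (-(1/2) : ℝ) 0,
      Tendsto (fun b : ℝ => gfun b / (1 - b) ^ 2) (nhdsWithin 1 (Iio 1)) (nhds E₂) ∧
      Tendsto (fun N : ℕ => cAb (Real.sqrt (2 * Real.pi * N)) / (2 * Real.pi * N))
        atTop (nhds E₂) := by
  refine ⟨limitEnergy, ⟨?_, limitEnergy_neg⟩, tendsto_gfun_div_sq, tendsto_cAb_div_sq⟩
  exact (neg_half_le_bulkEnergy le_rfl).trans (bulkEnergy_le_limitEnergy le_rfl)
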